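/- For every integer d ≥ 2, every n-vertex d-regular graph G satisfies tww(G) ≤ n^{(d−2)/(2d−2) + o(1)}, and moreover for almost all n-vertex d-regular graphs G (i.e., with probability tending to 1 for a uniformly random such graph as n → ∞) one has tww(G) = n^{(d−2)/(2d−2) + o(1)}. -/

import Mathlib

noncomputable section

namespace TwwPaper

open Finset

variable {V : Type*}

/-- The number of edges of `G` with both endpoints in `X`. -/
def edgesIn (G : SimpleGraph V) (X : Finset V) : ℕ :=
  Nat.card {e : Sym2 V // e ∈ G.edgeSet ∧ ∀ v ∈ e, v ∈ X}

/-- The number of edges of `G`. -/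
def edgeCount (G : SimpleGraph V) : ℕ := Nat.card G.edgeSet

/-- The maximum average degree of `G`: the maximum over nonempty vertex subsets `X`
of `2 e(G[X]) / |X|`. -/
def mad [Fintype V] (G : SimpleGraph V) : ℝ :=
  ⨆ X : {X : Finset V // X.Nonempty}, (2 * edgesIn G X.1 : ℝ) / X.1.card

/-- The degree of a vertex. -/
def deg (G : SimpleGraph V) (v : V) : ℕ := Nat.card (G.neighborSet v)

/-- The maximum degree `Δ(G)`. -/
def maxDeg [Fintype V] (G : SimpleGraph V) : ℕ := univ.sup (deg G)

/-- `G` is `d`-regular. -/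
def IsReg (G : SimpleGraph V) (d : ℕ) : Prop := ∀ v, deg G v = d

/-- `G` admits an orientation with maximum outdegree at most one:
an assignment of a tail (source) vertex to each edge, no vertex being
the tail of two distinct edges. -/
def HasOrientationOutdegLEOne (G : SimpleGraph V) : Prop :=
  ∃ f : G.edgeSet → V, (∀ e : G.edgeSet, f e ∈ (e : Sym2 V)) ∧ Function.Injective f

/-- Two lists (sequences) of the same length `r` are close if they contain a common
subsequence of length `r - 1`, obtained by deleting one entry from each. -/
def Close {S : Type*} (L M : List S) : Prop :=
  ∃ i < L.length, ∃ j < M.length, L.eraseIdx i = M.eraseIdx j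

section Partitions

variable [Fintype V] [DecidableEq V]

/-- `Q` is obtained from `P` by merging the two distinct parts `A` and `B`. -/
def IsMergeStep (P Q : Finpartition (univ : Finset V)) : Prop :=
  ∃ A ∈ P.parts, ∃ B ∈ P.parts, A ≠ B ∧
    Q.parts = insert (A ∪ B) ((P.parts.erase A).erase B)

/-- Degree of the part `A` in the quotient graph `G / P`. -/
def quotDeg (G : SimpleGraph V) (P : Finpartition (univ : Finset V)) (A : Finset V) : ℕ :=
  Nat.card {B : Finset V // B ∈ P.parts ∧ B ≠ A ∧ ∃ u ∈ A, ∃ v ∈ B, G.Adj u v}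

/-- Red degree of the part `A` with respect to the partition `P`: the number of other
parts `B` which are neither fully adjacent nor fully non-adjacent to `A`. -/
def redDeg (G : SimpleGraph V) (P : Finpartition (univ : Finset V)) (A : Finset V) : ℕ :=
  Nat.card {B : Finset V // B ∈ P.parts ∧ B ≠ A ∧ (∃ u ∈ A, ∃ v ∈ B, G.Adj u v) ∧
    ¬ (∀ u ∈ A, ∀ v ∈ B, G.Adj u v)}

/-- There is a sequence of partitions of `V(G)`, starting at the discrete partition,
ending with at most one part, each obtained from the previous one by merging two parts,
such that every part of every intermediate partition has `degFn`-degree at most `w`. -/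
def SeqOK (G : SimpleGraph V)
    (degFn : SimpleGraph V → Finpartition (univ : Finset V) → Finset V → ℕ) (w : ℕ) : Prop :=
  ∃ n : ℕ, ∃ P : Fin (n + 1) → Finpartition (univ : Finset V),
    (∀ A ∈ (P 0).parts, A.card = 1) ∧
    (P (Fin.last n)).parts.card ≤ 1 ∧
    (∀ i : Fin n, IsMergeStep (P i.castSucc) (P i.succ)) ∧
    (∀ i, ∀ A ∈ (P i).parts, degFn G (P i) A ≤ w)

/-- The sparse twin-width of `G`: the least `w` such that `G` can be contracted to a
single vertex by iterated pairwise identifications with all intermediate (quotient)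
graphs of maximum degree at most `w`. -/
def stww (G : SimpleGraph V) : ℕ := sInf {w | SeqOK G quotDeg w}

/-- The twin-width of `G`, via contraction sequences minimizing the maximum red degree. -/
def tww (G : SimpleGraph V) : ℕ := sInf {w | SeqOK G redDeg w}

/-- The quotient graph `G / P`: parts of `P` are adjacent iff some edge of `G` joins them. -/
def quotGraph (G : SimpleGraph V) (P : Finpartition (univ : Finset V)) :
    SimpleGraph {A : Finset V // A ∈ P.parts} :=
  SimpleGraph.fromRel (fun A B => ∃ u ∈ A.1, ∃ v ∈ B.1, G.Adj u v)

end Partitions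

/-- A graph is `w`-degenerate if every nonempty (induced) subgraph has a vertex of
degree at most `w` in it. -/
def Degenerate {W : Type*} (w : ℕ) (H : SimpleGraph W) : Prop :=
  ∀ s : Finset W, s.Nonempty → ∃ a ∈ s, Nat.card {b : W // b ∈ s ∧ H.Adj a b} ≤ w

/-- The graph `Π(r₁,…,r_a; b, q)`: vertices are tuples `(v₁,…,v_a)` with `vᵢ ∈ [q]^{rᵢ}`,
two tuples being adjacent iff (they are distinct and) at least `b` coordinates are
pairwise equal or close. -/
def PiGraph (a b q : ℕ) (rfn : Fin a → ℕ) : SimpleGraph (∀ i : Fin a, Fin (rfn i) → Fin q) :=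
  SimpleGraph.fromRel (fun u v => ∃ I : Finset (Fin a), I.card = b ∧
    ∀ i ∈ I, u i = v i ∨ Close (List.ofFn (u i)) (List.ofFn (v i)))

section Contraction

variable [Fintype V] [DecidableEq V]

/-- Every part of `P` has red degree at most `w`. -/
def RedDegLE (G : SimpleGraph V) (w : ℕ) (P : Finpartition (univ : Finset V)) : Prop :=
  ∀ A ∈ P.parts, redDeg G P A ≤ w

/-- `Q` arises from `P` by merge steps, all resulting partitions having red degree at most `w`. -/
def Contracts (G : SimpleGraph V) (w : ℕ) : Finpartition (univ : Finset V) →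
    Finpartition (univ : Finset V) → Prop :=
  Relation.ReflTransGen fun P Q => IsMergeStep P Q ∧ RedDegLE G w Q

lemma Contracts.exists_seq {G : SimpleGraph V} {w : ℕ} {P Q : Finpartition (univ : Finset V)}
    (h : Contracts G w P Q) : ∃ (n : ℕ) (R : ℕ → Finpartition (univ : Finset V)), R 0 = P ∧ R n = Q ∧
      ∀ i < n, IsMergeStep (R i) (R (i + 1)) ∧ RedDegLE G w (R (i + 1)) := by
  induction h with
  | refl => exact ⟨0, fun _ => P, rfl, rfl, by simp⟩
  | @tail Q Q' _ hstep ih =>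
    obtain ⟨n, R, h0, hn, hR⟩ := ih
    refine ⟨n + 1, Function.update R (n + 1) Q', ?_, by simp, ?_⟩
    · rw [Function.update_of_ne (by omega)]; exact h0
    · intro i hi
      rcases Nat.lt_succ_iff_lt_or_eq.mp hi with h | rfl
      · rw [Function.update_of_ne (by omega), Function.update_of_ne (by omega)]
        exact hR i h
      · rw [Function.update_of_ne (by omega), Function.update_self, hn]
        exact hstep

lemma Contracts.seqOK {G : SimpleGraph V} {w : ℕ} {P Q : Finpartition (univ : Finset V)}
    (h : Contracts G w P Q) (hP : ∀ A ∈ P.parts, A.card = 1) (hPw : RedDegLE G w P)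
    (hQ : Q.parts.card ≤ 1) : SeqOK G redDeg w := by
  obtain ⟨n, R, rfl, rfl, hR⟩ := h.exists_seq
  refine ⟨n, fun i => R i, hP, hQ, fun i => ?_, fun i => ?_⟩
  · simpa using (hR i i.2).1
  · obtain ⟨i, hi⟩ := i
    cases i with
    | zero => exact hPw
    | succ i => exact (hR i (by omega)).2

lemma Contracts.tww_le {G : SimpleGraph V} {w : ℕ} {P Q : Finpartition (univ : Finset V)}
    (h : Contracts G w P Q) (hP : ∀ A ∈ P.parts, A.card = 1) (hPw : RedDegLE G w P)
    (hQ : Q.parts.card ≤ 1) : tww G ≤ w :=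
  Nat.sInf_le (h.seqOK hP hPw hQ)

lemma exists_mergeStep_le {P Q : Finpartition (univ : Finset V)} (hPQ : P ≤ Q) (hne : P ≠ Q) :
    ∃ R, IsMergeStep P R ∧ P ≤ R ∧ R ≤ Q ∧ R.parts.card < P.parts.card := by
  obtain ⟨A, hA, B, hB, hAB, C, hC, hAC, hBC⟩ : ∃ A ∈ P.parts, ∃ B ∈ P.parts, A ≠ B ∧
      ∃ C ∈ Q.parts, A ⊆ C ∧ B ⊆ C := by
    by_contra! hcon
    refine hne (le_antisymm hPQ fun C hC => ?_)
    obtain ⟨A, hA, hAC⟩ := Finpartition.exists_le_of_le hPQ hC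
    refine ⟨A, hA, fun x hx => ?_⟩
    obtain ⟨B, hB, hxB⟩ := P.exists_mem (mem_univ x)
    obtain ⟨C', hC', hBC'⟩ := hPQ hB
    obtain rfl := Q.eq_of_mem_parts hC' hC (hBC' hxB) hx
    by_contra hxA
    refine hcon A hA B hB (fun h => hxA (h ▸ hxB)) C' hC hAC hBC'
  have hparts : ∀ D, D ∈ insert (A ∪ B) ((P.parts.erase A).erase B) ↔
      D = A ∪ B ∨ (D ≠ B ∧ D ≠ A ∧ D ∈ P.parts) := by intro D; simp
  let R : Finpartition (univ : Finset V) := Finpartition.ofExistsUnique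
    (insert (A ∪ B) ((P.parts.erase A).erase B)) (fun _ _ => subset_univ _)
    (by
      intro x _
      obtain ⟨D, hD, hxD⟩ := P.exists_mem (mem_univ x)
      by_cases hxAB : x ∈ A ∪ B
      · refine ⟨A ∪ B, ⟨by simp, hxAB⟩, ?_⟩
        rintro E ⟨hE, hxE⟩
        rcases (hparts E).mp hE with h | ⟨h1, h2, h3⟩
        · exact h
        · rcases mem_union.mp hxAB with h | h
          · exact absurd (P.eq_of_mem_parts h3 hA hxE h) h2
          · exact absurd (P.eq_of_mem_parts h3 hB hxE h) h1
      · have hDA : D ≠ A := by rintro rfl; exact hxAB (mem_union_left _ hxD)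
        have hDB : D ≠ B := by rintro rfl; exact hxAB (mem_union_right _ hxD)
        refine ⟨D, ⟨(hparts D).mpr (Or.inr ⟨hDB, hDA, hD⟩), hxD⟩, ?_⟩
        rintro E ⟨hE, hxE⟩
        rcases (hparts E).mp hE with rfl | ⟨h1, h2, h3⟩
        · exact absurd hxE hxAB
        · exact P.eq_of_mem_parts h3 hD hxE hxD)
    (by
      intro h
      rcases (hparts ∅).mp h with h | ⟨_, _, h⟩
      · have := P.nonempty_of_mem_parts hA
        have hs : A ⊆ A ∪ B := subset_union_left
        rw [← h] at hs
        exact this.ne_empty (subset_empty.mp hs)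
      · exact P.empty_notMem_parts h)
  have hR : R.parts = insert (A ∪ B) ((P.parts.erase A).erase B) := rfl
  refine ⟨R, ⟨A, hA, B, hB, hAB, hR⟩, ?_, ?_, ?_⟩
  · intro D hD
    by_cases hDA : D = A
    · exact ⟨A ∪ B, by simp [hR], hDA ▸ subset_union_left⟩
    by_cases hDB : D = B
    · exact ⟨A ∪ B, by simp [hR], hDB ▸ subset_union_right⟩
    exact ⟨D, by rw [hR]; exact (hparts D).mpr (Or.inr ⟨hDB, hDA, hD⟩), le_rfl⟩
  · intro D hD
    rw [hR] at hD
    rcases (hparts D).mp hD with rfl | ⟨_, _, h3⟩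
    · exact ⟨C, hC, union_subset hAC hBC⟩
    · exact hPQ h3
  · have h1 : B ∈ P.parts.erase A := mem_erase.mpr ⟨hAB.symm, hB⟩
    have h2 := card_insert_le (A ∪ B) ((P.parts.erase A).erase B)
    have h3 := card_erase_add_one h1
    have h4 := card_erase_add_one hA
    rw [hR]
    omega

lemma contracts_of_le {G : SimpleGraph V} {w : ℕ} (Q : Finpartition (univ : Finset V)) :
    ∀ (P : Finpartition (univ : Finset V)), P ≤ Q →
      (∀ R, P ≤ R → R ≤ Q → RedDegLE G w R) → Contracts G w P Q := by
  intro P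
  induction hk : P.parts.card using Nat.strong_induction_on generalizing P with
  | _ k ih =>
    intro hPQ hR
    by_cases hne : P = Q
    · subst hne; exact Relation.ReflTransGen.refl
    obtain ⟨R, hstep, hPR, hRQ, hcard⟩ := exists_mergeStep_le hPQ hne
    exact Relation.ReflTransGen.head ⟨hstep, hR R hPR hRQ⟩
      (ih _ (hk ▸ hcard) R rfl hRQ fun S hS => hR S (hPR.trans hS))

/-- The partition of `V` into the fibers of `φ`. -/
def fiberPartition {α : Type*} [DecidableEq α] (φ : V → α) : Finpartition (univ : Finset V) :=
  Finpartition.ofExistsUnique (univ.image fun a => univ.filter fun b => φ b = φ a)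
    (fun _ _ => subset_univ _)
    (by
      intro x _
      refine ⟨univ.filter fun b => φ b = φ x, by simp, ?_⟩
      simp only [mem_image, mem_univ, true_and]
      rintro _ ⟨⟨a, rfl⟩, hx⟩
      simp only [mem_filter, mem_univ, true_and] at hx
      rw [hx])
    (by
      simp only [mem_image, mem_univ, true_and, not_exists]
      intro a h
      have : a ∈ univ.filter fun b => φ b = φ a := by simp
      rw [h] at this
      simp at this)

lemma mem_fiberPartition {α : Type*} [DecidableEq α] (φ : V → α) (A : Finset V) :
    A ∈ (fiberPartition φ).parts ↔ ∃ a, (univ.filter fun b => φ b = φ a) = A := by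
  simp [fiberPartition, Finpartition.ofExistsUnique]

lemma contracts_fiberPartition {α β : Type*} [DecidableEq α] [DecidableEq β] (G : SimpleGraph V)
    (w : ℕ) (φ : V → α) (ψ : V → β) (h : ∀ u v, φ u = φ v → ψ u = ψ v)
    (hw : ∀ u, ∃ T : Finset α, T.card ≤ w ∧ ∀ u' v, ψ u' = ψ u → G.Adj u' v → φ v ∈ T) :
    Contracts G w (fiberPartition φ) (fiberPartition ψ) := by
  refine contracts_of_le _ _ ?_ ?_
  · intro A hA
    obtain ⟨a, rfl⟩ := (mem_fiberPartition φ A).mp hA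
    refine ⟨univ.filter fun b => ψ b = ψ a, (mem_fiberPartition _ _).mpr ⟨a, rfl⟩, fun x hx => ?_⟩
    simp only [mem_filter, mem_univ, true_and] at hx ⊢
    exact h _ _ hx
  · intro R hφR hRψ A hA
    obtain ⟨C, hC, hAC⟩ := hRψ hA
    obtain ⟨u, rfl⟩ := (mem_fiberPartition ψ C).mp hC
    obtain ⟨T, hT, hTw⟩ := hw u
    refine le_trans ?_ hT
    have hx : ∀ B : {B : Finset V // B ∈ R.parts ∧ B ≠ A ∧ (∃ u ∈ A, ∃ v ∈ B, G.Adj u v) ∧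
        ¬ (∀ u ∈ A, ∀ v ∈ B, G.Adj u v)}, ∃ v ∈ B.1, φ v ∈ T := by
      rintro ⟨B, hB, -, ⟨u', hu', v, hv, hadj⟩, -⟩
      have := hAC hu'
      simp only [mem_filter, mem_univ, true_and] at this
      exact ⟨v, hv, hTw u' v this hadj⟩
    choose g hg1 hg2 using hx
    have hcard : Nat.card T = T.card := by simp
    rw [redDeg, ← hcard]
    refine Nat.card_le_card_of_injective (fun B => (⟨φ (g B), hg2 B⟩ : T)) ?_
    intro B B' hBB
    simp only [Subtype.mk.injEq] at hBB
    obtain ⟨D, hD, hsub⟩ := hφR ((mem_fiberPartition φ _).mpr ⟨g B, rfl⟩)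
    have h1 : D = B.1 := R.eq_of_mem_parts hD B.2.1 (hsub (by simp)) (hg1 B)
    have h2 : D = B'.1 := R.eq_of_mem_parts hD B'.2.1 (hsub (by simp [hBB])) (hg1 B')
    exact Subtype.ext (h1 ▸ h2)

end Contraction

section EdgeColouring

lemma card_filter_mem_of_card_fiber {H X : Type*} [DecidableEq X] (s : H → X) {k : ℕ}
    (S : Finset H) (hs : ∀ x, (S.filter fun h => s h = x).card = k) (A : Finset X) :
    (S.filter fun h => s h ∈ A).card = k * A.card := by
  have hmaps : Set.MapsTo s (S.filter fun h => s h ∈ A : Finset H) (A : Set X) :=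
    fun h hh => (mem_filter.mp (mem_coe.mp hh)).2
  rw [card_eq_sum_card_fiberwise hmaps, sum_congr rfl (g := fun _ => k), sum_const, smul_eq_mul,
    mul_comm]
  intro x hx
  rw [← hs x, filter_filter]
  congr 1
  ext h
  simp only [mem_filter]
  exact ⟨fun ⟨a, _, c⟩ => ⟨a, c⟩, fun ⟨a, b⟩ => ⟨a, b ▸ hx, b⟩⟩

/-- König's edge colouring theorem for regular bipartite multigraphs: the edges are the elements
of `S`, with ends given by `s` and `t`. -/
theorem exists_edgeColouring {H X Y : Type*} [Fintype X] [Fintype Y] [DecidableEq X]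
    [DecidableEq Y] [DecidableEq H] (s : H → X) (t : H → Y) : ∀ (k : ℕ) (S : Finset H),
    (∀ x, (S.filter fun h => s h = x).card = k) → (∀ y, (S.filter fun h => t h = y).card = k) →
    ∃ c : H → ℕ, (∀ h ∈ S, c h < k) ∧
      (∀ h ∈ S, ∀ h' ∈ S, s h = s h' → c h = c h' → h = h') ∧
      (∀ h ∈ S, ∀ h' ∈ S, t h = t h' → c h = c h' → h = h') := by
  intro k
  induction k with
  | zero =>
    intro S hs _
    have hS : S = ∅ := by
      rw [eq_empty_iff_forall_notMem]
      intro h hh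
      have := hs (s h)
      rw [card_eq_zero, filter_eq_empty_iff] at this
      exact this hh rfl
    subst hS
    exact ⟨fun _ => 0, by simp, by simp, by simp⟩
  | succ k ih =>
    intro S hs ht
    have hall : ∀ A : Finset X,
        A.card ≤ (A.biUnion fun x => (S.filter fun h => s h = x).image t).card := by
      intro A
      set B := A.biUnion fun x => (S.filter fun h => s h = x).image t with hB
      have h1 := card_filter_mem_of_card_fiber s S hs A
      have h2 := card_filter_mem_of_card_fiber t S ht B
      have h3 : (S.filter fun h => s h ∈ A) ⊆ S.filter fun h => t h ∈ B := by
        intro h hh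
        rw [mem_filter] at hh ⊢
        refine ⟨hh.1, mem_biUnion.mpr ⟨s h, hh.2, mem_image.mpr ⟨h, by simp [hh.1], rfl⟩⟩⟩
      have h4 := card_le_card h3
      rw [h1, h2] at h4
      exact Nat.le_of_mul_le_mul_left h4 (Nat.succ_pos k)
    obtain ⟨f, hfinj, hf⟩ := (all_card_le_biUnion_card_iff_exists_injective _).mp hall
    simp only [mem_image, mem_filter] at hf
    choose g hg hgt using hf
    have hXY : Fintype.card X = Fintype.card Y := by
      have h1 := card_filter_mem_of_card_fiber s S hs univ
      have h2 := card_filter_mem_of_card_fiber t S ht univ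
      simp only [mem_univ, filter_true] at h1 h2
      exact Nat.eq_of_mul_eq_mul_left (Nat.succ_pos k) (h1.symm.trans h2)
    have hfbij : Function.Bijective f :=
      (Fintype.bijective_iff_injective_and_card f).mpr ⟨hfinj, hXY⟩
    set M := univ.image g with hM
    have hMs : ∀ x, (M.filter fun h => s h = x) = {g x} := by
      intro x
      ext h
      simp only [hM, mem_filter, mem_image, mem_univ, true_and, mem_singleton]
      constructor
      · rintro ⟨⟨z, rfl⟩, h⟩
        rw [← h, (hg z).2]
      · rintro rfl
        exact ⟨⟨x, rfl⟩, (hg x).2⟩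
    have hMt : ∀ x, (M.filter fun h => t h = f x) = {g x} := by
      intro x
      ext h
      simp only [hM, mem_filter, mem_image, mem_univ, true_and, mem_singleton]
      constructor
      · rintro ⟨⟨z, rfl⟩, h⟩
        rw [hgt z] at h
        rw [hfinj h]
      · rintro rfl
        exact ⟨⟨x, rfl⟩, hgt x⟩
    have hMS : M ⊆ S := by
      intro h hh
      simp only [hM, mem_image, mem_univ, true_and] at hh
      obtain ⟨x, rfl⟩ := hh
      exact (hg x).1
    have hsub : ∀ (p : H → Prop) [DecidablePred p], ((S \ M).filter p).card =
        (S.filter p).card - (M.filter p).card := by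
      intro p _
      have : (S \ M).filter p = S.filter p \ M.filter p := by
        ext h; simp only [mem_filter, mem_sdiff]; tauto
      rw [this, card_sdiff_of_subset (filter_subset_filter _ hMS)]
    obtain ⟨c, hc, hcs, hct⟩ := ih (S \ M)
      (fun x => by rw [hsub, hs, hMs]; simp)
      (fun y => by
        obtain ⟨x, rfl⟩ := hfbij.2 y
        rw [hsub, ht, hMt]; simp)
    refine ⟨fun h => if h ∈ M then k else c h, ?_, ?_, ?_⟩
    · intro h hh
      by_cases hm : h ∈ M
      · simp [hm]
      · simp only [hm, if_false]
        have := hc h (mem_sdiff.mpr ⟨hh, hm⟩)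
        omega
    · intro h hh h' hh' hss hcc
      by_cases hm : h ∈ M <;> by_cases hm' : h' ∈ M
      · have h1 : h ∈ M.filter fun z => s z = s h' := by simp [hm, hss]
        have h2 : h' ∈ M.filter fun z => s z = s h' := by simp [hm']
        rw [hMs, mem_singleton] at h1 h2
        exact h1.trans h2.symm
      · simp only [hm, hm', if_true, if_false] at hcc
        have := hc h' (mem_sdiff.mpr ⟨hh', hm'⟩)
        omega
      · simp only [hm, hm', if_true, if_false] at hcc
        have := hc h (mem_sdiff.mpr ⟨hh, hm⟩)
        omega
      · simp only [hm, hm', if_false] at hcc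
        exact hcs h (mem_sdiff.mpr ⟨hh, hm⟩) h' (mem_sdiff.mpr ⟨hh', hm'⟩) hss hcc
    · intro h hh h' hh' hss hcc
      by_cases hm : h ∈ M <;> by_cases hm' : h' ∈ M
      · obtain ⟨x, hx⟩ := hfbij.2 (t h')
        have h1 : h ∈ M.filter fun z => t z = f x := by simp [hm, hss, hx]
        have h2 : h' ∈ M.filter fun z => t z = f x := by simp [hm', hx]
        rw [hMt, mem_singleton] at h1 h2
        exact h1.trans h2.symm
      · simp only [hm, hm', if_true, if_false] at hcc
        have := hc h' (mem_sdiff.mpr ⟨hh', hm'⟩)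
        omega
      · simp only [hm, hm', if_true, if_false] at hcc
        have := hc h (mem_sdiff.mpr ⟨hh, hm⟩)
        omega
      · simp only [hm, hm', if_false] at hcc
        exact hct h (mem_sdiff.mpr ⟨hh, hm⟩) h' (mem_sdiff.mpr ⟨hh', hm'⟩) hss hcc

lemma deg_eq_degree (G : SimpleGraph V) (v : V) [Fintype (G.neighborSet v)] :
    deg G v = G.degree v := by
  rw [deg, Nat.card_eq_fintype_card, SimpleGraph.card_neighborSet_eq_degree]

/-- The neighbours of each vertex of a `d`-regular graph can be enumerated so that the two
directions of an edge always get different indices. -/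
theorem exists_neighbour_functions [Fintype V] {d : ℕ} (hd : 2 ≤ d) (G : SimpleGraph V)
    (hG : IsReg G d) : ∃ f : Fin d → V → V, (∀ i v, G.Adj v (f i v)) ∧
      ∀ u v, G.Adj u v → ∃ i j, i ≠ j ∧ f i u = v ∧ f j v = u := by
  classical
  let s : (G.Dart ⊕ G.Dart) ⊕ (G.edgeSet × Fin (d - 2)) → V ⊕ G.edgeSet :=
    Sum.elim (Sum.elim (fun a => Sum.inl a.fst) (fun a => Sum.inr ⟨a.edge, a.edge_mem⟩))
      (fun p => Sum.inr p.1)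
  let t : (G.Dart ⊕ G.Dart) ⊕ (G.edgeSet × Fin (d - 2)) → V ⊕ G.edgeSet :=
    Sum.elim (Sum.elim (fun a => Sum.inr ⟨a.edge, a.edge_mem⟩) (fun a => Sum.inl a.fst))
      (fun p => Sum.inr p.1)
  have hsum : ∀ (p : (G.Dart ⊕ G.Dart) ⊕ (G.edgeSet × Fin (d - 2)) → Prop) [DecidablePred p],
      (univ.filter p).card = (univ.filter fun a => p (Sum.inl (Sum.inl a))).card +
        (univ.filter fun a => p (Sum.inl (Sum.inr a))).card +
        (univ.filter fun a => p (Sum.inr a)).card := by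
    intro p _
    simp only [card_filter, Fintype.sum_sum_type]
  have hV : ∀ v, (univ.filter fun a : G.Dart => a.fst = v).card = d := by
    intro v
    rw [G.dart_fst_fiber_card_eq_degree, ← deg_eq_degree, hG v]
  have hE : ∀ e : G.edgeSet, (univ.filter fun a : G.Dart => a.edge = e.1).card = 2 :=
    fun e => G.dart_edge_fiber_card e.1 e.2
  have hP : ∀ e : G.edgeSet, (univ.filter fun p : G.edgeSet × Fin (d - 2) => p.1 = e).card
      = d - 2 := by
    intro e
    have : (univ.filter fun p : G.edgeSet × Fin (d - 2) => p.1 = e) = {e} ×ˢ univ := by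
      ext p
      simp only [mem_filter, mem_univ, mem_product, mem_singleton, true_and, and_true]
    rw [this, card_product]; simp
  have hfs : ∀ x, (univ.filter fun h => s h = x).card = d := by
    rintro (v | e)
    · rw [hsum]; simp [s, hV]
    · rw [hsum]
      simp only [s, Sum.elim_inl, Sum.elim_inr, Sum.inr.injEq, Subtype.ext_iff, reduceCtorEq,
        filter_false, card_empty]
      rw [hE]
      have := hP e
      simp only [Subtype.ext_iff] at this
      rw [this]; omega
  have hft : ∀ x, (univ.filter fun h => t h = x).card = d := by
    rintro (v | e)
    · rw [hsum]; simp [t, hV]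
    · rw [hsum]
      simp only [t, Sum.elim_inl, Sum.elim_inr, Sum.inr.injEq, Subtype.ext_iff, reduceCtorEq,
        filter_false, card_empty]
      rw [hE]
      have := hP e
      simp only [Subtype.ext_iff] at this
      rw [this]; omega
  obtain ⟨c, hc, hcs, hct⟩ := exists_edgeColouring s t d univ hfs hft
  let c' : G.Dart → Fin d := fun a => ⟨c (Sum.inl (Sum.inl a)), hc _ (mem_univ _)⟩
  have hinj1 : ∀ a b : G.Dart, a.fst = b.fst → c' a = c' b → a = b := by
    intro a b hab hcc
    have := hcs (Sum.inl (Sum.inl a)) (mem_univ _) (Sum.inl (Sum.inl b)) (mem_univ _)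
      (by simp [s, hab]) (by simpa [c'] using hcc)
    simpa using this
  have hinj2 : ∀ a b : G.Dart, a.edge = b.edge → c' a = c' b → a = b := by
    intro a b hab hcc
    have := hct (Sum.inl (Sum.inl a)) (mem_univ _) (Sum.inl (Sum.inl b)) (mem_univ _)
      (by simp [t, hab]) (by simpa [c'] using hcc)
    simpa using this
  have hsurj : ∀ v i, ∃ a : G.Dart, a.fst = v ∧ c' a = i := by
    intro v i
    have : (univ.filter fun a : G.Dart => a.fst = v).image c' = univ := by
      rw [← card_eq_iff_eq_univ, card_image_of_injOn, hV, Fintype.card_fin]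
      intro a ha b hb hab
      rw [mem_coe, mem_filter] at ha hb
      exact hinj1 a b (ha.2.trans hb.2.symm) hab
    have hi : i ∈ (univ.filter fun a : G.Dart => a.fst = v).image c' := this ▸ mem_univ i
    simpa using hi
  choose a ha hca using hsurj
  refine ⟨fun i v => (a v i).snd, fun i v => ?_, fun u v huv => ?_⟩
  · have := (a v i).adj
    rwa [ha v i] at this
  · let e : G.Dart := ⟨(u, v), huv⟩
    refine ⟨c' e, c' e.symm, fun h => ?_, ?_, ?_⟩
    · exact e.symm_ne (hinj2 e.symm e (by simp) h.symm)
    · have : a u (c' e) = e := hinj1 _ _ (ha _ _) (hca _ _)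
      simp [this, e]
    · have : a v (c' e.symm) = e.symm := hinj1 _ _ (ha _ _) (hca _ _)
      simp only [this]
      simp [e]

end EdgeColouring

section Sources

/-- The number of times the `f`-trajectory of `v` of length `r` visits `x`. -/
def visits [DecidableEq V] (f : V → V) (r : ℕ) (v x : V) : ℕ :=
  ((range r).filter fun k => f^[k] v = x).card

lemma visits_apply_add [DecidableEq V] (f : V → V) (r : ℕ) (v x : V) :
    visits f r (f v) x + (if v = x then 1 else 0) =
      visits f r v x + (if f^[r] v = x then 1 else 0) := by
  simp only [visits, card_filter]
  rw [← sum_range_succ (fun k => if f^[k] v = x then 1 else 0) r, sum_range_succ']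
  simp only [Function.iterate_succ_apply, Function.iterate_zero, id]
  congr 2

lemma visits_le [DecidableEq V] (f : V → V) (r : ℕ) (v x : V) : visits f r v x ≤ r :=
  (card_filter_le _ _).trans (by simp)

variable [Fintype V] [DecidableEq V]

/-- The visits of the trajectory of `v`, recorded as vertices with visit numbers. -/
def sources (f : V → V) (r : ℕ) (v : V) : Finset (V × Fin r) :=
  univ.filter fun p => (p.2 : ℕ) < visits f r v p.1

lemma card_sources (f : V → V) (r : ℕ) (v : V) : (sources f r v).card = r := by
  have h : ∀ x, (∑ j : Fin r, if (j : ℕ) < visits f r v x then 1 else 0) = visits f r v x := by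
    intro x
    rw [← card_filter, Fin.card_filter_val_lt, min_eq_right (visits_le f r v x)]
  rw [sources, card_filter, Fintype.sum_prod_type]
  rw [sum_congr rfl fun x _ => h x]
  unfold visits
  rw [← card_eq_sum_card_fiberwise (f := fun k => f^[k] v) (t := univ) (fun _ _ => mem_univ _),
    card_range]

lemma card_sources_sdiff_apply (f : V → V) (r : ℕ) (v : V) :
    (sources f r v \ sources f r (f v)).card ≤ 1 := by
  have key : ∀ p ∈ sources f r v \ sources f r (f v),
      p.1 = v ∧ (p.2 : ℕ) + 1 = visits f r v v := by
    rintro ⟨x, j⟩ hp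
    simp only [sources, mem_sdiff, mem_filter, mem_univ, true_and, not_lt] at hp
    have h := visits_apply_add f r v x
    obtain ⟨h1, h2⟩ := hp
    by_cases hvx : v = x
    · subst hvx
      simp only [if_true] at h
      refine ⟨rfl, ?_⟩
      simp only
      omega
    · rw [if_neg hvx] at h
      omega
  rw [card_le_one]
  intro p hp q hq
  obtain ⟨h1, h2⟩ := key p hp
  obtain ⟨h3, h4⟩ := key q hq
  exact Prod.ext (h1.trans h3.symm) (Fin.ext (by omega))

lemma card_sources_apply_sdiff (f : V → V) (r : ℕ) (v : V) :
    (sources f r (f v) \ sources f r v).card ≤ 1 := by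
  rw [card_sdiff_comm (by rw [card_sources, card_sources])]
  exact card_sources_sdiff_apply f r v

lemma card_iterate_fiber_le {f : V → V} {d : ℕ} (hf : ∀ x, (univ.filter fun u => f u = x).card ≤ d)
    (k : ℕ) (x : V) : (univ.filter fun u => f^[k] u = x).card ≤ d ^ k := by
  induction k with
  | zero =>
    refine card_le_one.mpr fun u hu w hw => ?_
    rw [mem_filter] at hu hw
    exact hu.2.trans hw.2.symm
  | succ k ih =>
    rw [pow_succ, mul_comm]
    refine (card_le_mul_card_image_of_maps_to (f := f)
      (t := univ.filter fun u => f^[k] u = x) (fun u hu => ?_) d fun y _ => ?_).trans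
      (Nat.mul_le_mul_left _ ih)
    · rw [mem_filter] at hu ⊢
      exact ⟨mem_univ _, hu.2⟩
    · refine (card_le_card ?_).trans (hf y)
      intro u hu
      simp only [mem_filter, mem_univ, true_and] at hu ⊢
      exact hu.2

/-- The sources of `v` with respect to each of a family of functions. -/
def allSources {d : ℕ} (f : Fin d → V → V) (r : ℕ) (v : V) : Finset (Fin d × V × Fin r) :=
  univ.filter fun p => p.2 ∈ sources (f p.1) r v

lemma card_allSources {d : ℕ} (f : Fin d → V → V) (r : ℕ) (v : V) :
    (allSources f r v).card = d * r := by
  rw [allSources, card_filter, Fintype.sum_prod_type]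
  simp only [← card_filter, filter_univ_mem, card_sources]
  simp

lemma card_not_disjoint_allSources_le {d : ℕ} (f : Fin d → V → V) (r : ℕ)
    (hf : ∀ i x, (univ.filter fun u => f i u = x).card ≤ d) (hd : 0 < d) (v : V) :
    (univ.filter fun u => ¬ Disjoint (allSources f r u) (allSources f r v)).card ≤
      d * (r * (r * d ^ r)) := by
  have hpos : ∀ (i : Fin d) (u x : V) (j : Fin r), (x, j) ∈ sources (f i) r u →
      ∃ k ∈ range r, (f i)^[k] u = x := by
    intro i u x j h
    simp only [sources, mem_filter, mem_univ, true_and] at h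
    have : 0 < visits (f i) r u x := by omega
    rw [visits, card_pos] at this
    obtain ⟨k, hk⟩ := this
    exact ⟨k, (mem_filter.mp hk).1, (mem_filter.mp hk).2⟩
  have hsub : (univ.filter fun u => ¬ Disjoint (allSources f r u) (allSources f r v)) ⊆
      (univ : Finset (Fin d)).biUnion fun i => (range r).biUnion fun l => (range r).biUnion fun k =>
        univ.filter fun u => (f i)^[k] u = (f i)^[l] v := by
    intro u hu
    simp only [mem_filter, mem_univ, true_and, not_disjoint_iff, allSources] at hu
    obtain ⟨⟨i, x, j⟩, h1, h2⟩ := hu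
    obtain ⟨k, hk, hku⟩ := hpos i u x j h1
    obtain ⟨l, hl, hlv⟩ := hpos i v x j h2
    simp only [mem_biUnion, mem_filter, mem_univ, true_and]
    exact ⟨i, l, hl, k, hk, hku.trans hlv.symm⟩
  refine (card_le_card hsub).trans ?_
  have h1 := card_biUnion_le_card_mul (univ : Finset (Fin d)) (fun i => (range r).biUnion fun l =>
    (range r).biUnion fun k => univ.filter fun u => (f i)^[k] u = (f i)^[l] v) (r * (r * d ^ r)) ?_
  · simpa using h1
  intro i _
  have h2 := card_biUnion_le_card_mul (range r) (fun l =>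
    (range r).biUnion fun k => univ.filter fun u => (f i)^[k] u = (f i)^[l] v) (r * d ^ r) ?_
  · simpa using h2
  intro l _
  have h3 := card_biUnion_le_card_mul (range r) (fun k =>
    univ.filter fun u => (f i)^[k] u = (f i)^[l] v) (d ^ r) ?_
  · simpa using h3
  intro k hk
  exact (card_iterate_fiber_le (hf i) k _).trans
    (Nat.pow_le_pow_right hd (mem_range.mp hk).le)

end Sources

section SpreadColouring

variable {U : Type*} [Fintype U] [DecidableEq U] [Fintype V] [DecidableEq V]

/-- The sets `S v`, `v ∈ J`, receive the same colours under `c`. -/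
def SameColours {q : ℕ} (S : V → Finset U) (c : U → Fin q) (J : Finset V) : Prop :=
  ∀ u ∈ J, ∀ v ∈ J, (S u).image c ⊆ (S v).image c

/-- The sets `S v`, `v ∈ J`, are pairwise disjoint. -/
def FarApart (S : V → Finset U) (J : Finset V) : Prop :=
  ∀ u ∈ J, ∀ v ∈ J, u ≠ v → Disjoint (S u) (S v)

lemma card_colouring_eq_comp_mul_le {q : ℕ} (A T : Finset U) (hAT : Disjoint A T)
    (h : T → A) :
    (univ.filter fun c : U → Fin q => ∀ t : T, c t = c (h t)).card * q ^ T.card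
      ≤ q ^ Fintype.card U := by
  have hle : T.card ≤ Fintype.card U := card_le_univ T
  have h1 : (univ.filter fun c : U → Fin q => ∀ t : T, c t = c (h t)).card ≤
      Fintype.card ({x // x ∉ T} → Fin q) := by
    rw [← card_univ]
    refine card_le_card_of_injOn (fun c x => c x.1) (fun _ _ => mem_univ _) ?_
    intro c hc c' hc' hcc
    rw [mem_coe, mem_filter] at hc hc'
    have hout : ∀ x, x ∉ T → c x = c' x := fun x hx => congrFun hcc ⟨x, hx⟩
    funext x
    by_cases hx : x ∈ T
    · have := disjoint_left.mp hAT (h ⟨x, hx⟩).2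
      rw [hc.2 ⟨x, hx⟩, hc'.2 ⟨x, hx⟩, hout _ this]
    · exact hout x hx
  have h2 : Fintype.card ({x // x ∉ T} → Fin q) = q ^ (Fintype.card U - T.card) := by
    rw [Fintype.card_fun, Fintype.card_fin, Fintype.card_subtype_compl, Fintype.card_coe]
  calc _ ≤ q ^ (Fintype.card U - T.card) * q ^ T.card := Nat.mul_le_mul_right _ (h2 ▸ h1)
    _ = q ^ Fintype.card U := by rw [← pow_add, Nat.sub_add_cancel hle]

open Classical in
lemma card_sameColours_mul_le {V : Type*} [DecidableEq V] {q a p : ℕ}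
    (S : V → Finset U) (hS : ∀ v, (S v).card = a)
    (J : Finset V) (hJ : J.card = p) (hp : 1 ≤ p) (hfar : FarApart S J) :
    (univ.filter fun c : U → Fin q => SameColours S c J).card * q ^ (a * (p - 1)) ≤
      a ^ (a * (p - 1)) * q ^ Fintype.card U := by
  obtain ⟨v, hv⟩ : J.Nonempty := card_pos.mp (by omega)
  set T := (J.erase v).biUnion S with hT
  have hTcard : T.card = a * (p - 1) := by
    rw [hT, card_biUnion (fun x hx y hy hxy =>
      hfar x (mem_of_mem_erase hx) y (mem_of_mem_erase hy) hxy), sum_congr rfl fun x _ => hS x,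
      sum_const, card_erase_of_mem hv, hJ, smul_eq_mul, mul_comm]
  have hdisj : Disjoint (S v) T := by
    rw [hT, disjoint_biUnion_right]
    intro x hx
    exact hfar v hv x (mem_of_mem_erase hx) (ne_of_mem_erase hx).symm
  have hsub : (univ.filter fun c : U → Fin q => SameColours S c J) ⊆
      (univ : Finset (T → S v)).biUnion fun h =>
        univ.filter fun c : U → Fin q => ∀ t : T, c t = c (h t) := by
    intro c hc
    simp only [mem_filter, mem_univ, true_and] at hc
    have : ∀ t : T, ∃ s : S v, c t = c s := by
      rintro ⟨t, ht⟩
      obtain ⟨x, hx, htx⟩ := mem_biUnion.mp ht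
      have := hc x (mem_of_mem_erase hx) v hv (mem_image_of_mem c htx)
      obtain ⟨s, hs, hsc⟩ := mem_image.mp this
      exact ⟨⟨s, hs⟩, hsc.symm⟩
    choose h hh using this
    simp only [mem_biUnion, mem_filter, mem_univ, true_and]
    exact ⟨h, hh⟩
  calc _ ≤ (∑ h : T → S v, (univ.filter fun c : U → Fin q => ∀ t : T, c t = c (h t)).card) *
        q ^ (a * (p - 1)) := Nat.mul_le_mul_right _ ((card_le_card hsub).trans card_biUnion_le)
    _ = ∑ h : T → S v, (univ.filter fun c : U → Fin q => ∀ t : T, c t = c (h t)).card *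
        q ^ T.card := by rw [sum_mul, hTcard]
    _ ≤ ∑ _h : T → S v, q ^ Fintype.card U :=
        sum_le_sum fun h _ => card_colouring_eq_comp_mul_le (S v) T hdisj h
    _ = _ := by
        rw [sum_const, card_univ, Fintype.card_fun, Fintype.card_coe, Fintype.card_coe, hS, hTcard,
          smul_eq_mul]

/-- If the sets `S v` have size `a` and few of them meet, then for some colouring with `q` colours
every family of sets with the same colours is small. -/
theorem exists_spread_colouring {q a p K : ℕ} (S : V → Finset U) (hS : ∀ v, (S v).card = a)
    (ha : 0 < a) (hp : 1 ≤ p) (hq : 0 < q)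
    (hK : ∀ v, (univ.filter fun u => ¬ Disjoint (S u) (S v)).card ≤ K) :
    ∃ c : U → Fin q, ∀ X : Finset V, SameColours S c X → ∃ L, X.card ≤ K * L ∧
      L.choose p * q ^ (a * (p - 1)) ≤ Fintype.card V ^ p * a ^ (a * (p - 1)) := by
  classical
  have : Nonempty (Fin q) := ⟨⟨0, hq⟩⟩
  set F := (powersetCard p (univ : Finset V)).filter fun J => FarApart S J with hF
  obtain ⟨c, -, hc⟩ : ∃ c ∈ (univ : Finset (U → Fin q)),
      (F.filter fun J => SameColours S c J).card * q ^ (a * (p - 1)) ≤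
        (Fintype.card V).choose p * a ^ (a * (p - 1)) := by
    refine exists_le_of_sum_le univ_nonempty ?_
    rw [← sum_mul]
    have hswap : ∑ c : U → Fin q, (F.filter fun J => SameColours S c J).card =
        ∑ J ∈ F, (univ.filter fun c : U → Fin q => SameColours S c J).card := by
      simp only [card_filter]
      exact sum_comm
    rw [hswap, sum_mul]
    have hFcard : F.card ≤ (Fintype.card V).choose p := by
      refine (card_filter_le _ _).trans ?_
      rw [card_powersetCard, card_univ]
    calc _ ≤ ∑ J ∈ F, a ^ (a * (p - 1)) * q ^ Fintype.card U := by
          refine sum_le_sum fun J hJ => ?_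
          rw [hF, mem_filter, mem_powersetCard] at hJ
          exact card_sameColours_mul_le S hS J hJ.1.2 hp hJ.2
      _ = F.card * (a ^ (a * (p - 1)) * q ^ Fintype.card U) := by rw [sum_const, smul_eq_mul]
      _ ≤ (Fintype.card V).choose p * (a ^ (a * (p - 1)) * q ^ Fintype.card U) :=
          Nat.mul_le_mul_right _ hFcard
      _ = _ := by
          rw [sum_const, card_univ, Fintype.card_fun, Fintype.card_fin, smul_eq_mul]
          ring
  refine ⟨c, fun X hX => ?_⟩
  obtain ⟨I, hI, hmax⟩ := exists_max_image (X.powerset.filter fun J => FarApart S J) card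
    ⟨∅, mem_filter.mpr ⟨empty_mem_powerset _, fun u hu => absurd hu (notMem_empty u)⟩⟩
  rw [mem_filter, mem_powerset] at hI
  refine ⟨I.card, ?_, ?_⟩
  · have hcover : X ⊆ I.biUnion fun v => univ.filter fun u => ¬ Disjoint (S u) (S v) := by
      intro u hu
      by_contra hcon
      simp only [mem_biUnion, mem_filter, mem_univ, true_and, not_exists, not_and, not_not] at hcon
      have huI : u ∉ I := by
        intro h
        have := hcon u h
        rw [disjoint_self_iff_empty] at this
        have h2 := hS u
        rw [this, card_empty] at h2
        omega
      have := hmax (insert u I) (by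
        rw [mem_filter, mem_powerset]
        refine ⟨insert_subset hu hI.1, ?_⟩
        intro x hx y hy hxy
        rcases mem_insert.mp hx with hxu | hx
        · rcases mem_insert.mp hy with hyu | hy
          · exact absurd (hxu.trans hyu.symm) hxy
          · exact hxu ▸ hcon y hy
        · rcases mem_insert.mp hy with hyu | hy
          · exact hyu ▸ (hcon x hx).symm
          · exact hI.2 x hx y hy hxy)
      rw [card_insert_of_notMem huI] at this
      omega
    calc X.card ≤ _ := card_le_card hcover
      _ ≤ I.card * K := card_biUnion_le_card_mul _ _ _ fun v _ => hK v
      _ = _ := mul_comm _ _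
  · have hsub : powersetCard p I ⊆ F.filter fun J => SameColours S c J := by
      intro J hJ
      rw [mem_powersetCard] at hJ
      rw [mem_filter, hF, mem_filter, mem_powersetCard]
      exact ⟨⟨⟨subset_univ _, hJ.2⟩, fun x hx y hy => hI.2 x (hJ.1 hx) y (hJ.1 hy)⟩,
        fun x hx y hy => hX x (hI.1 (hJ.1 hx)) y (hI.1 (hJ.1 hy))⟩
    have h1 := card_le_card hsub
    rw [card_powersetCard] at h1
    calc _ ≤ _ := Nat.mul_le_mul_right _ h1
      _ ≤ _ := hc
      _ ≤ _ := Nat.mul_le_mul_right _ (Nat.choose_le_pow _ _)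

end SpreadColouring

section Labels

variable [Fintype V] [DecidableEq V]

lemma redDegLE_of_card_eq_one (G : SimpleGraph V) (w : ℕ) (P : Finpartition (univ : Finset V))
    (hP : ∀ A ∈ P.parts, A.card = 1) : RedDegLE G w P := by
  intro A hA
  refine le_trans (le_of_eq ?_) (Nat.zero_le w)
  rw [redDeg, Nat.card_eq_zero]
  left
  refine ⟨fun ⟨B, hB, _, ⟨u, hu, v, hv, huv⟩, hn⟩ => hn fun u' hu' v' hv' => ?_⟩
  rwa [card_le_one.mp (hP A hA).le u' hu' u hu, card_le_one.mp (hP B hB).le v' hv' v hv]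

lemma card_eq_one_of_mem_fiberPartition_id {A : Finset V}
    (hA : A ∈ (fiberPartition (id : V → V)).parts) : A.card = 1 := by
  obtain ⟨a, rfl⟩ := (mem_fiberPartition _ _).mp hA
  rw [card_eq_one]
  exact ⟨a, by ext; simp⟩

lemma card_fiberPartition_le_one {α : Type*} [DecidableEq α] (φ : V → α)
    (h : ∀ u v, φ u = φ v) : (fiberPartition φ).parts.card ≤ 1 := by
  refine card_le_one.mpr fun A hA B hB => ?_
  obtain ⟨a, rfl⟩ := (mem_fiberPartition _ _).mp hA
  obtain ⟨b, rfl⟩ := (mem_fiberPartition _ _).mp hB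
  simp [h a b]

lemma exists_image_subset_insert {α : Type*} [DecidableEq α] {Q : ℕ} (hQ : 0 < Q) (g : α → ℕ)
    (hg : ∀ x, g x < Q) (A B : Finset α) (h : (A \ B).card ≤ 1) :
    ∃ b ∈ range Q, A.image g ⊆ insert b (B.image g) := by
  obtain h0 | ⟨x, hx⟩ := (A \ B).eq_empty_or_nonempty
  · refine ⟨0, mem_range.mpr hQ, (image_subset_image ?_).trans (subset_insert _ _)⟩
    exact sdiff_eq_empty_iff_subset.mp h0
  · refine ⟨g x, mem_range.mpr (hg x), ?_⟩
    rw [← image_insert]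
    refine image_subset_image fun y hy => ?_
    by_cases hyB : y ∈ B
    · exact mem_insert_of_mem hyB
    · rw [card_le_one.mp h y (mem_sdiff.mpr ⟨hy, hyB⟩) x hx]
      exact mem_insert_self _ _

/-- The level-`l` label of a vertex: the colours of its sources, up to their last `l` bits. -/
def label {d r Q : ℕ} (f : Fin d → V → V) (c : Fin d × V × Fin r → Fin Q) (l : ℕ) (v : V) :
    Fin d → Finset ℕ :=
  fun i => (sources (f i) r v).image fun p => (c (i, p) : ℕ) / 2 ^ l

variable {d r Q : ℕ} (f : Fin d → V → V) (c : Fin d × V × Fin r → Fin Q)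

lemma label_succ (l : ℕ) (v : V) (i : Fin d) :
    label f c (l + 1) v i = (label f c l v i).image (· / 2) := by
  simp only [label, image_image, Function.comp_def, Nat.div_div_eq_div_mul, pow_succ]

lemma card_label_le (l : ℕ) (v : V) (i : Fin d) : (label f c l v i).card ≤ r :=
  card_image_le.trans (card_sources _ _ _).le

/-- The sets of at most `r` labels below `Q`, with multiplicities forgotten. -/
def labelSets (r Q : ℕ) : Finset (Finset ℕ) :=
  univ.image fun h : Fin r → Fin Q => univ.image fun k => (h k : ℕ)

lemma card_labelSets_le (r Q : ℕ) : (labelSets r Q).card ≤ Q ^ r := by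
  refine card_image_le.trans ?_
  simp

lemma label_mem_labelSets (l : ℕ) (v : V) (i : Fin d) : label f c l v i ∈ labelSets r Q := by
  let e := (sources (f i) r v).equivFinOfCardEq (card_sources _ _ _)
  rw [labelSets, mem_image]
  refine ⟨fun k => ⟨(c (i, (e.symm k).1) : ℕ) / 2 ^ l,
    (Nat.div_le_self _ _).trans_lt (c _).2⟩, mem_univ _, ?_⟩
  ext x
  simp only [label, mem_image, mem_univ, true_and]
  constructor
  · rintro ⟨k, rfl⟩
    exact ⟨(e.symm k).1, (e.symm k).2, rfl⟩
  · rintro ⟨p, hp, rfl⟩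
    exact ⟨e ⟨p, hp⟩, by simp⟩

/-- The sets whose halves lie in `L`, apart from one. -/
def nearSets (Q : ℕ) (L : Finset ℕ) : Finset (Finset ℕ) :=
  (range Q).biUnion fun b => ((insert b L).biUnion fun y => {2 * y, 2 * y + 1}).powerset

lemma card_nearSets_le (Q : ℕ) {L : Finset ℕ} {r : ℕ} (hL : L.card ≤ r) :
    (nearSets Q L).card ≤ Q * 2 ^ (2 * r + 2) := by
  have := card_biUnion_le_card_mul (range Q)
    (fun b => ((insert b L).biUnion fun y => {2 * y, 2 * y + 1}).powerset) (2 ^ (2 * r + 2)) ?_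
  · simpa [nearSets] using this
  intro b _
  rw [card_powerset]
  refine Nat.pow_le_pow_right two_pos ?_
  refine (card_biUnion_le_card_mul (insert b L) _ 2 fun y _ => card_le_two).trans ?_
  have := card_insert_le b L
  omega

lemma mem_nearSets {Q b : ℕ} {L A : Finset ℕ} (hb : b ∈ range Q)
    (h : A.image (· / 2) ⊆ insert b L) : A ∈ nearSets Q L := by
  refine mem_biUnion.mpr ⟨b, hb, mem_powerset.mpr fun x hx => ?_⟩
  refine mem_biUnion.mpr ⟨x / 2, h (mem_image_of_mem _ hx), ?_⟩
  rw [mem_insert, mem_singleton]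
  omega

lemma exists_label_finset (hQ : 0 < Q) (G : SimpleGraph V)
    (hf : ∀ u v, G.Adj u v → ∃ i j, i ≠ j ∧ f i u = v ∧ f j v = u) (l : ℕ)
    (L : Fin d → Finset ℕ) (hL : ∀ i, (L i).card ≤ r) :
    ∃ T : Finset (Fin d → Finset ℕ),
      T.card ≤ d ^ 2 * ((Q * 2 ^ (2 * r + 2)) ^ 2 * (Q ^ r) ^ (d - 2)) ∧
      ∀ u v, label f c (l + 1) u = L → G.Adj u v → label f c l v ∈ T := by
  classical
  refine ⟨(univ.filter fun p : Fin d × Fin d => p.1 ≠ p.2).biUnion fun p =>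
    Fintype.piFinset fun k => if k ∈ ({p.1, p.2} : Finset (Fin d)) then nearSets Q (L k)
      else labelSets r Q, ?_, ?_⟩
  · refine (card_biUnion_le_card_mul _ _
      ((Q * 2 ^ (2 * r + 2)) ^ 2 * (Q ^ r) ^ (d - 2)) fun p hp => ?_).trans ?_
    · rw [Fintype.card_piFinset]
      have h2 : ({p.1, p.2} : Finset (Fin d)).card = 2 := card_pair (mem_filter.mp hp).2
      calc _ ≤ ∏ k : Fin d, if k ∈ ({p.1, p.2} : Finset (Fin d)) then Q * 2 ^ (2 * r + 2)
            else Q ^ r := by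
            refine prod_le_prod' fun k _ => ?_
            split_ifs
            · exact card_nearSets_le Q (hL k)
            · exact card_labelSets_le r Q
        _ = _ := by
            rw [prod_ite, prod_const, prod_const, filter_univ_mem, h2]
            congr 2
            rw [filter_not, filter_univ_mem, card_univ_sdiff, Fintype.card_fin, h2]
    · refine Nat.mul_le_mul_right _ ((card_le_univ _).trans ?_)
      rw [Fintype.card_prod, Fintype.card_fin, sq]
  · intro u v hu huv
    obtain ⟨i, j, hij, hi, hj⟩ := hf u v huv
    refine mem_biUnion.mpr ⟨(i, j), mem_filter.mpr ⟨mem_univ _, hij⟩, ?_⟩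
    rw [Fintype.mem_piFinset]
    intro k
    split_ifs with hk
    · have hcard : (sources (f k) r v \ sources (f k) r u).card ≤ 1 := by
        rcases mem_insert.mp hk with rfl | hk
        · rw [← hi]; exact card_sources_apply_sdiff _ _ _
        · rw [mem_singleton.mp hk, ← hj]; exact card_sources_sdiff_apply _ _ _
      obtain ⟨b, hb, hsub⟩ := exists_image_subset_insert hQ
        (fun p => (c (k, p) : ℕ) / 2 ^ (l + 1))
        (fun p => (Nat.div_le_self _ _).trans_lt (c _).2) _ _ hcard
      refine mem_nearSets hb ?_
      rw [← label_succ, ← hu]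
      exact hsub
    · exact label_mem_labelSets _ _ _ _ _

/-- A colouring under which few vertices have sources of the same colours gives a contraction
sequence. -/
theorem tww_le_of_colouring {s F : ℕ} (hr : 0 < r) (G : SimpleGraph V)
    (hf : ∀ u v, G.Adj u v → ∃ i j, i ≠ j ∧ f i u = v ∧ f j v = u)
    (c : Fin d × V × Fin r → Fin (2 ^ s))
    (hF : ∀ X : Finset V, SameColours (allSources f r) c X → X.card ≤ F) :
    tww G ≤ max (d * F)
      (d ^ 2 * ((2 ^ s * 2 ^ (2 * r + 2)) ^ 2 * ((2 ^ s) ^ r) ^ (d - 2))) := by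
  set w := max (d * F)
      (d ^ 2 * ((2 ^ s * 2 ^ (2 * r + 2)) ^ 2 * ((2 ^ s) ^ r) ^ (d - 2))) with hw
  have h0 : Contracts G w (fiberPartition id) (fiberPartition (label f c 0)) := by
    refine contracts_fiberPartition G w _ _ (fun u v h => congrArg _ h) fun u => ?_
    refine ⟨(univ ×ˢ univ.filter fun x => label f c 0 x = label f c 0 u).image
      fun p => f p.1 p.2, ?_, ?_⟩
    · refine card_image_le.trans (le_trans ?_ (le_max_left _ _))
      rw [card_product, card_univ, Fintype.card_fin]
      refine Nat.mul_le_mul_left _ (hF _ ?_)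
      intro x hx y hy a ha
      rw [mem_filter] at hx hy
      obtain ⟨⟨i, p⟩, hp, rfl⟩ := mem_image.mp ha
      have hp2 : p ∈ sources (f i) r x := (mem_filter.mp hp).2
      have h1 : (c (i, p) : ℕ) / 2 ^ 0 ∈ label f c 0 y i := by
        rw [hy.2, ← hx.2]
        exact mem_image.mpr ⟨p, hp2, rfl⟩
      obtain ⟨p', hp', he⟩ := mem_image.mp h1
      simp only [pow_zero, Nat.div_one] at he
      exact mem_image.mpr ⟨(i, p'), mem_filter.mpr ⟨mem_univ _, hp'⟩, Fin.ext he⟩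
    · intro u' v hu' huv
      obtain ⟨i, j, -, hi, -⟩ := hf u' v huv
      exact mem_image.mpr ⟨(i, u'), mem_product.mpr ⟨mem_univ _,
        mem_filter.mpr ⟨mem_univ _, hu'⟩⟩, hi⟩
  have hstep : ∀ l, Contracts G w (fiberPartition (label f c l))
      (fiberPartition (label f c (l + 1))) := by
    intro l
    refine contracts_fiberPartition G w _ _ (fun u v h => ?_) fun u => ?_
    · funext i
      rw [label_succ, label_succ, h]
    · obtain ⟨T, hT, hT'⟩ := exists_label_finset f c (by positivity) G hf l
        (label f c (l + 1) u) (card_label_le f c _ u)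
      exact ⟨T, hT.trans (le_max_right _ _), hT'⟩
  have hall : ∀ l, Contracts G w (fiberPartition id) (fiberPartition (label f c l)) := by
    intro l
    induction l with
    | zero => exact h0
    | succ l ih => exact ih.trans (hstep l)
  refine (hall s).tww_le (fun A => card_eq_one_of_mem_fiberPartition_id)
    (redDegLE_of_card_eq_one G w _ fun A => card_eq_one_of_mem_fiberPartition_id)
    (card_fiberPartition_le_one _ ?_)
  have hconst : ∀ v, label f c s v = fun _ => {0} := by
    intro v
    funext i
    have hne : (sources (f i) r v).Nonempty := by
      rw [← card_pos, card_sources]; exact hr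
    rw [label, ← image_const hne]
    refine image_congr fun p _ => ?_
    exact Nat.div_eq_of_lt (c _).2
  intro u v
  rw [hconst, hconst]

end Labels

section UpperBound

lemma tww_le_of_choose_bound [Fintype V] [DecidableEq V] {d r p s M : ℕ} (hd : 2 ≤ d) (hr : 0 < r)
    (hp : 1 ≤ p) (G : SimpleGraph V) (hG : IsReg G d)
    (hM : ∀ L : ℕ, L.choose p * (2 ^ s) ^ (d * r * (p - 1)) ≤
      Fintype.card V ^ p * (d * r) ^ (d * r * (p - 1)) → L ≤ M) :
    tww G ≤ max (d * (d * (r * (r * d ^ r)) * M))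
      (d ^ 2 * ((2 ^ s * 2 ^ (2 * r + 2)) ^ 2 * ((2 ^ s) ^ r) ^ (d - 2))) := by
  classical
  obtain ⟨f, hf1, hf2⟩ := exists_neighbour_functions hd G hG
  have hfib : ∀ i x, (univ.filter fun u => f i u = x).card ≤ d := by
    intro i x
    rw [← hG x, deg_eq_degree, ← SimpleGraph.card_neighborFinset_eq_degree]
    refine card_le_card fun u hu => ?_
    rw [mem_filter] at hu
    rw [SimpleGraph.mem_neighborFinset, ← hu.2]
    exact (hf1 i u).symm
  have hd0 : 0 < d := by omega
  obtain ⟨c, hc⟩ := exists_spread_colouring (q := 2 ^ s) (p := p) (allSources f r)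
    (card_allSources f r) (Nat.mul_pos hd0 hr) hp (by positivity)
    (card_not_disjoint_allSources_le f r hfib hd0)
  refine tww_le_of_colouring f hr G hf2 c fun X hX => ?_
  obtain ⟨L, hXL, hL⟩ := hc X hX
  exact hXL.trans (Nat.mul_le_mul_left _ (hM L hL))

lemma le_of_choose_mul_pow_le {n p A L : ℕ} {x : ℝ} {q : ℕ} {γ : ℝ} (hn : 1 ≤ n) (hp : 1 ≤ p)
    (hq : (n : ℝ) ^ γ ≤ 2 ^ A * (q : ℝ) ^ A) (hγ1 : γ ≤ 1) (hx : x = 1 - γ + 1 / p)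
    (h : L.choose p * q ^ (A * (p - 1)) ≤ n ^ p * A ^ (A * (p - 1))) :
    (L : ℝ) ≤ p + (p.factorial * (2 ^ A * A ^ A) ^ (p - 1) : ℕ) * (n : ℝ) ^ x := by
  have hn0 : (0 : ℝ) < n := by exact_mod_cast hn
  have hn1 : (1 : ℝ) ≤ n := by exact_mod_cast hn
  set C : ℕ := p.factorial * (2 ^ A * A ^ A) ^ (p - 1) with hC
  have hC1 : 1 ≤ C := by
    rw [hC]
    have hA : 0 < A ^ A := by
      rcases A.eq_zero_or_pos with rfl | hA
      · simp
      · positivity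
    have := p.factorial_pos
    exact Nat.one_le_iff_ne_zero.mpr (by positivity)
  have hC1' : (1 : ℝ) ≤ C := by exact_mod_cast hC1
  have hnx : 0 ≤ (n : ℝ) ^ x := Real.rpow_nonneg hn0.le x
  rcases Nat.lt_or_ge L p with hLp | hLp
  · have : (L : ℝ) ≤ p := by exact_mod_cast hLp.le
    have : 0 ≤ (C : ℝ) * (n : ℝ) ^ x := by positivity
    linarith
  set y := L + 1 - p with hy
  have hLy : (L : ℝ) ≤ p + y := by
    have : L ≤ p + y := by omega
    exact_mod_cast this
  suffices hs : (y : ℝ) ≤ C * (n : ℝ) ^ x by linarith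
  have h1 : (y : ℝ) ^ p * ((n : ℝ) ^ γ) ^ (p - 1) ≤ C * (n : ℝ) ^ p := by
    have ha : (y : ℝ) ^ p ≤ p.factorial * L.choose p := by
      have := Nat.pow_le_choose p L (α := ℝ)
      rw [div_le_iff₀ (by exact_mod_cast p.factorial_pos), mul_comm] at this
      exact_mod_cast this
    have hb : ((n : ℝ) ^ γ) ^ (p - 1) ≤ (2 ^ A * (q : ℝ) ^ A) ^ (p - 1) :=
      pow_le_pow_left₀ (Real.rpow_nonneg hn0.le _) hq _
    have hc : (L.choose p : ℝ) * (q : ℝ) ^ (A * (p - 1)) ≤ (n : ℝ) ^ p * (A : ℝ) ^ (A * (p - 1)) := by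
      exact_mod_cast h
    calc (y : ℝ) ^ p * ((n : ℝ) ^ γ) ^ (p - 1)
        ≤ (p.factorial * L.choose p) * (2 ^ A * (q : ℝ) ^ A) ^ (p - 1) := by gcongr
      _ = p.factorial * (2 ^ A) ^ (p - 1) * (L.choose p * (q : ℝ) ^ (A * (p - 1))) := by
          rw [mul_pow, pow_mul (q : ℝ)]; ring
      _ ≤ p.factorial * (2 ^ A) ^ (p - 1) * ((n : ℝ) ^ p * (A : ℝ) ^ (A * (p - 1))) := by gcongr
      _ = C * (n : ℝ) ^ p := by
          rw [hC, pow_mul (A : ℝ)]; push_cast; ring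
  have hp0 : (0 : ℝ) < p := by exact_mod_cast hp
  refine le_of_pow_le_pow_left₀ (by omega : p ≠ 0) (by positivity) ?_
  have hpow : ((n : ℝ) ^ γ) ^ (p - 1) = (n : ℝ) ^ (γ * (p - 1)) := by
    rw [← Real.rpow_natCast, ← Real.rpow_mul hn0.le, Nat.cast_sub hp, Nat.cast_one]
  have hpos : 0 < (n : ℝ) ^ (γ * (p - 1)) := Real.rpow_pos_of_pos hn0 _
  rw [hpow] at h1
  have h2 : (C : ℝ) * (n : ℝ) ^ p ≤ (C * (n : ℝ) ^ x) ^ p * (n : ℝ) ^ (γ * (p - 1)) := by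
    rw [mul_pow, ← Real.rpow_natCast ((n : ℝ) ^ x), ← Real.rpow_mul hn0.le, mul_assoc,
      ← Real.rpow_add hn0, ← Real.rpow_natCast (n : ℝ)]
    have hexp : (p : ℝ) ≤ x * p + γ * (p - 1) := by
      have : x * p = p - γ * p + 1 := by rw [hx]; field_simp
      rw [this]; linarith
    have e1 := Real.rpow_le_rpow_of_exponent_le hn1 hexp
    have e2 : (C : ℝ) ≤ (C : ℝ) ^ p := le_self_pow₀ hC1' (by omega)
    gcongr
  exact le_of_mul_le_mul_right (h1.trans h2) hpos

lemma exists_forall_mul_rpow_le (C : ℝ) {a b : ℝ} (hab : a < b) :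
    ∃ N : ℕ, ∀ n : ℕ, N ≤ n → C * (n : ℝ) ^ a ≤ (n : ℝ) ^ b := by
  have h := (tendsto_rpow_atTop (sub_pos.mpr hab)).comp tendsto_natCast_atTop_atTop
  obtain ⟨N, hN⟩ := Filter.eventually_atTop.mp
    ((h.eventually_ge_atTop C).and (Filter.eventually_ge_atTop 1))
  refine ⟨N, fun n hn => ?_⟩
  obtain ⟨h1, h2⟩ := hN n hn
  have hn0 : (0 : ℝ) < n := by exact_mod_cast h2
  have : (n : ℝ) ^ b = (n : ℝ) ^ (b - a) * (n : ℝ) ^ a := by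
    rw [← Real.rpow_add hn0]; ring_nf
  rw [this]
  exact mul_le_mul_of_nonneg_right h1 (Real.rpow_nonneg hn0.le _)

/-- Every `d`-regular graph on `n` vertices has twin-width `n ^ ((d - 2) / (2 * d - 2) + o(1))`. -/
theorem tww_le_rpow (d : ℕ) (hd : 2 ≤ d) (ε : ℝ) (hε : 0 < ε) : ∃ N : ℕ, ∀ n : ℕ, N ≤ n →
    ∀ G : SimpleGraph (Fin n), IsReg G d →
      (tww G : ℝ) ≤ (n : ℝ) ^ (((d : ℝ) - 2) / (2 * (d : ℝ) - 2) + ε) := by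
  set α : ℝ := ((d : ℝ) - 2) / (2 * (d : ℝ) - 2) with hα
  have hdR : (2 : ℝ) ≤ d := by exact_mod_cast hd
  have hden : (0 : ℝ) < 2 * (d : ℝ) - 2 := by linarith
  obtain ⟨r, hr⟩ := exists_nat_gt (2 / ε)
  have hr0' : (0 : ℝ) < r := lt_trans (by positivity) hr
  have hr0 : 0 < r := by exact_mod_cast hr0'
  have hrε : 1 / (r : ℝ) < ε / 2 := by
    rw [div_lt_iff₀ hε] at hr
    rw [div_lt_iff₀ hr0']
    linarith
  set A := d * r with hA
  set C₁ : ℕ := r.factorial * (2 ^ A * A ^ A) ^ (r - 1) with hC₁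
  set K₁ : ℕ := d * (d * (r * (r * d ^ r))) with hK₁
  set K₂ : ℝ := (d : ℝ) ^ 2 * (2 ^ (2 * r + 2)) ^ 2 with hK₂
  obtain ⟨N₁, hN₁⟩ := exists_forall_mul_rpow_le (K₁ * (r + C₁))
    (show α + ε / 2 < α + ε by linarith)
  obtain ⟨N₂, hN₂⟩ := exists_forall_mul_rpow_le K₂ (show α + ε / 2 < α + ε by linarith)
  refine ⟨max 1 (max N₁ N₂), fun n hn G hG => ?_⟩
  have hn1 : 1 ≤ n := (le_max_left _ _).trans hn
  have hnN₁ : N₁ ≤ n := ((le_max_left _ _).trans (le_max_right _ _)).trans hn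
  have hnN₂ : N₂ ≤ n := ((le_max_right _ _).trans (le_max_right _ _)).trans hn
  have hn1' : (1 : ℝ) ≤ n := by exact_mod_cast hn1
  have hn0 : (0 : ℝ) < n := by linarith
  have hα0 : 0 ≤ α := div_nonneg (by linarith) hden.le
  set θ : ℝ := 1 / (r * (2 * d - 2)) with hθ
  have hθ0 : 0 ≤ θ := by positivity
  obtain ⟨s, hs1, hs2⟩ := exists_nat_pow_near (Real.one_le_rpow hn1' hθ0) (one_lt_two (α := ℝ))
  set x : ℝ := 1 - d / (2 * d - 2) + 1 / (r : ℝ) with hx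
  have hαd : α = 1 - d / (2 * d - 2) := by
    rw [hα, eq_sub_iff_add_eq, ← add_div, div_eq_one_iff_eq hden.ne']
    ring
  have hxle : x ≤ α + ε / 2 := by rw [hx, ← hαd]; linarith
  have hq : (n : ℝ) ^ ((d : ℝ) / (2 * d - 2)) ≤ 2 ^ A * ((2 ^ s : ℕ) : ℝ) ^ A := by
    have h1 : (n : ℝ) ^ θ ≤ 2 * 2 ^ s := by rw [pow_succ] at hs2; linarith
    have h2 := pow_le_pow_left₀ (Real.rpow_nonneg hn0.le θ) h1 A
    rw [← Real.rpow_natCast, ← Real.rpow_mul hn0.le, mul_pow] at h2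
    have h3 : θ * (A : ℝ) = (d : ℝ) / (2 * d - 2) := by
      rw [hθ, hA]; push_cast; field_simp
    rw [h3] at h2
    push_cast
    exact h2
  have hM : ∀ L : ℕ, L.choose r * (2 ^ s) ^ (d * r * (r - 1)) ≤
      Fintype.card (Fin n) ^ r * (d * r) ^ (d * r * (r - 1)) →
      L ≤ ⌊(r : ℝ) + C₁ * (n : ℝ) ^ x⌋₊ := by
    intro L hL
    rw [Fintype.card_fin] at hL
    refine Nat.le_floor (le_of_choose_mul_pow_le hn1 hr0 hq ?_ hx hL)
    rw [div_le_one hden]; linarith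
  refine (Nat.cast_le.mpr (tww_le_of_choose_bound hd hr0 hr0 G hG hM)).trans ?_
  rw [Nat.cast_max]
  refine max_le ?_ ?_
  · refine le_trans ?_ (hN₁ n hnN₁)
    have hfl := Nat.floor_le (a := (r : ℝ) + C₁ * (n : ℝ) ^ x) (by positivity)
    have hxx : (n : ℝ) ^ x ≤ (n : ℝ) ^ (α + ε / 2) := Real.rpow_le_rpow_of_exponent_le hn1' hxle
    have h1 : (1 : ℝ) ≤ (n : ℝ) ^ (α + ε / 2) := Real.one_le_rpow hn1' (by linarith)
    calc ((d * (d * (r * (r * d ^ r)) * ⌊(r : ℝ) + C₁ * (n : ℝ) ^ x⌋₊) : ℕ) : ℝ)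
        = K₁ * (⌊(r : ℝ) + C₁ * (n : ℝ) ^ x⌋₊ : ℕ) := by
          rw [hK₁]; push_cast; ring
      _ ≤ K₁ * (r * (n : ℝ) ^ (α + ε / 2) + C₁ * (n : ℝ) ^ (α + ε / 2)) := by
          gcongr
          refine hfl.trans ?_
          gcongr
          nlinarith
      _ = _ := by ring
  · refine le_trans ?_ (hN₂ n hnN₂)
    have hexp : θ * (2 + r * (d - 2) : ℕ) ≤ α + ε / 2 := by
      have h1 : θ * (2 + r * (d - 2) : ℕ) = 2 * θ + α := by
        rw [hθ, hα]
        push_cast [Nat.cast_sub hd]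
        field_simp
      have h2 : 2 * θ ≤ 1 / r := by
        rw [hθ, mul_one_div, div_le_div_iff₀ (by positivity) hr0']
        nlinarith
      linarith
    calc ((d ^ 2 * ((2 ^ s * 2 ^ (2 * r + 2)) ^ 2 * ((2 ^ s) ^ r) ^ (d - 2)) : ℕ) : ℝ)
        = K₂ * ((2 : ℝ) ^ s) ^ (2 + r * (d - 2)) := by
          rw [hK₂]; push_cast; ring
      _ ≤ K₂ * ((n : ℝ) ^ θ) ^ (2 + r * (d - 2)) := by gcongr
      _ = K₂ * (n : ℝ) ^ (θ * (2 + r * (d - 2) : ℕ)) := by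
          rw [← Real.rpow_natCast ((n : ℝ) ^ θ), ← Real.rpow_mul hn0.le]
      _ ≤ _ := by
          gcongr

end UpperBound

section Blocks

variable [Fintype V] [DecidableEq V]

/-- A set of vertices that is an interval with respect to the values of `pos`. -/
def IntervalOf (pos : V → ℕ) (A : Finset V) : Prop :=
  ∀ u ∈ A, ∀ w ∈ A, ∀ v, pos u ≤ pos v → pos v ≤ pos w → v ∈ A

lemma IsMergeStep.le {P Q : Finpartition (univ : Finset V)} (h : IsMergeStep P Q) : P ≤ Q := by
  obtain ⟨A, hA, B, hB, hAB, hQ⟩ := h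
  intro C hC
  by_cases hCA : C = A
  · exact ⟨A ∪ B, by simp [hQ], hCA ▸ subset_union_left⟩
  by_cases hCB : C = B
  · exact ⟨A ∪ B, by simp [hQ], hCB ▸ subset_union_right⟩
  exact ⟨C, by simp [hQ, hCA, hCB, hC], le_rfl⟩

lemma exists_pos_of_mergeSteps (P : ℕ → Finpartition (univ : Finset V))
    (h0 : ∀ A ∈ (P 0).parts, A.card = 1) (k : ℕ)
    (hP : ∀ i < k, IsMergeStep (P i) (P (i + 1))) :
    ∃ pos : V → ℕ, ∀ A ∈ (P k).parts, Set.InjOn pos A ∧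
      ∀ j ≤ k, ∀ B ∈ (P j).parts, ∀ u ∈ B, ∀ w ∈ B, ∀ v ∈ A, u ∈ A →
        pos u ≤ pos v → pos v ≤ pos w → v ∈ B := by
  induction k with
  | zero =>
    refine ⟨fun _ => 0, fun A hA => ⟨fun x hx y hy _ => ?_, fun j hj B hB u hu w hw v hv huA _ _ => ?_⟩⟩
    · exact card_le_one.mp (h0 A hA).le x hx y hy
    · rw [card_le_one.mp (h0 A hA).le v hv u huA]
      exact hu
  | succ k ih =>
    obtain ⟨pos, hpos⟩ := ih fun i hi => hP i (by omega)
    obtain ⟨A, hA, B, hB, hAB, hQ⟩ := hP k (by omega)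
    have hmono : ∀ j ≤ k, P j ≤ P k := by
      intro j hj
      have : ∀ i, j + i ≤ k → P j ≤ P (j + i) := by
        intro i
        induction i with
        | zero => intro _; exact le_rfl
        | succ i ih => exact fun hi => (ih (by omega)).trans (hP (j + i) (by omega)).le
      simpa [Nat.add_sub_cancel' hj] using this (k - j) (by omega)
    have hdisj : Disjoint A B := (P k).disjoint hA hB hAB
    set M := univ.sup pos + 1 with hM
    have hlt : ∀ v, pos v < M := fun v => Nat.lt_succ_of_le (le_sup (mem_univ v))
    have hposA : ∀ v ∈ A, v ∉ B := fun v hv => disjoint_left.mp hdisj hv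
    refine ⟨fun v => if v ∈ B then M + pos v else pos v, ?_⟩
    have hold : ∀ C ∈ (P k).parts, ∀ u ∈ C, ∀ v ∈ C,
        (((if u ∈ B then M + pos u else pos u) ≤ (if v ∈ B then M + pos v else pos v)) ↔
          pos u ≤ pos v) := by
      intro C hC u hu v hv
      by_cases hCB : C = B
      · rw [hCB] at hu hv
        rw [if_pos hu, if_pos hv, Nat.add_le_add_iff_left]
      · have hd : Disjoint C B := (P k).disjoint hC hB hCB
        rw [if_neg (disjoint_left.mp hd hu), if_neg (disjoint_left.mp hd hv)]
    have hsub : ∀ j ≤ k, ∀ B' ∈ (P j).parts, ∀ E ∈ (P k).parts, ∀ u ∈ B', u ∈ E → B' ⊆ E := by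
      intro j hj B' hB' E hE u hu huE
      obtain ⟨E', hE', hBE'⟩ := hmono j hj hB'
      rwa [(P k).eq_of_mem_parts hE' hE (hBE' hu) huE] at hBE'
    intro C hC
    constructor
    · intro x hx y hy hxy
      have hsame : ∀ E ∈ (P k).parts, x ∈ E → y ∈ E → x = y := by
        intro E hE hxE hyE
        refine (hpos E hE).1 hxE hyE (le_antisymm ?_ ?_)
        · exact (hold E hE x hxE y hyE).mp hxy.le
        · exact (hold E hE y hyE x hxE).mp hxy.ge
      rw [hQ, mem_insert, mem_erase, mem_erase] at hC
      rcases hC with rfl | hC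
      · rcases mem_union.mp hx with hxA | hxB <;> rcases mem_union.mp hy with hyA | hyB
        · exact hsame A hA hxA hyA
        · have h1 := hlt x
          simp only [hposA x hxA, hyB, if_true, if_false] at hxy
          omega
        · have h1 := hlt y
          simp only [hposA y hyA, hxB, if_true, if_false] at hxy
          omega
        · exact hsame B hB hxB hyB
      · exact hsame C hC.2.2 hx hy
    · intro j hj B' hB' u hu w hw v hv huC huv hvw
      rcases Nat.lt_succ_iff_lt_or_eq.mp (Nat.lt_succ_of_le hj) with hj | rfl
      · have hj' : j ≤ k := by omega
        have hsame : ∀ E ∈ (P k).parts, u ∈ E → v ∈ E → v ∈ B' := by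
          intro E hE huE hvE
          have hwE := hsub j hj' B' hB' E hE u hu huE hw
          exact (hpos E hE).2 j hj' B' hB' u hu w hw v hvE huE
            ((hold E hE u huE v hvE).mp huv) ((hold E hE v hvE w hwE).mp hvw)
        rw [hQ, mem_insert, mem_erase, mem_erase] at hC
        rcases hC with rfl | hC
        · rcases mem_union.mp huC with huA | huB <;> rcases mem_union.mp hv with hvA | hvB
          · exact hsame A hA huA hvA
          · have hwA := hsub j hj' B' hB' A hA u hu huA hw
            have h1 := hlt w
            simp only [hposA w hwA, hvB, if_true, if_false] at hvw
            omega
          · have h1 := hlt v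
            simp only [hposA v hvA, huB, if_true, if_false] at huv
            omega
          · exact hsame B hB huB hvB
        · exact hsame C hC.2.2 huC hv
      · rwa [(P (k + 1)).eq_of_mem_parts hB' hC hu huC]

lemma exists_linear_pos (P : ℕ → Finpartition (univ : Finset V))
    (h0 : ∀ A ∈ (P 0).parts, A.card = 1) (k : ℕ)
    (hP : ∀ i < k, IsMergeStep (P i) (P (i + 1))) (hk : (P k).parts.card ≤ 1) :
    ∃ pos : V → ℕ, Function.Injective pos ∧ (∀ v, pos v < Fintype.card V) ∧
      ∀ j ≤ k, ∀ B ∈ (P j).parts, IntervalOf pos B := by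
  obtain ⟨pos, hpos⟩ := exists_pos_of_mergeSteps P h0 k hP
  have htop : ∀ _ : V, ∃ A ∈ (P k).parts, ∀ u, u ∈ A := by
    intro v
    obtain ⟨A, hA, -⟩ := (P k).exists_mem (mem_univ v)
    refine ⟨A, hA, fun u => ?_⟩
    obtain ⟨B, hB, hu⟩ := (P k).exists_mem (mem_univ u)
    rwa [card_le_one.mp hk A hA B hB]
  have hinj : Function.Injective pos := by
    intro u v huv
    obtain ⟨A, hA, hall⟩ := htop u
    exact (hpos A hA).1 (hall u) (hall v) huv
  let rank : V → ℕ := fun v => (univ.filter fun u => pos u < pos v).card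
  have hrank : ∀ u v, rank u ≤ rank v → pos u ≤ pos v := by
    intro u v h
    by_contra hlt
    rw [not_le] at hlt
    refine absurd h (not_le.mpr (card_lt_card ?_))
    rw [ssubset_iff_of_subset fun x hx => by
      rw [mem_filter] at hx ⊢; exact ⟨hx.1, hx.2.trans hlt⟩]
    exact ⟨v, mem_filter.mpr ⟨mem_univ _, hlt⟩, fun h => lt_irrefl _ (mem_filter.mp h).2⟩
  refine ⟨rank, fun u v h => hinj (le_antisymm (hrank u v h.le) (hrank v u h.ge)), fun v => ?_,
    ?_⟩
  · rw [← card_univ]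
    refine card_lt_card ?_
    rw [ssubset_iff_of_subset (subset_univ _)]
    exact ⟨v, mem_univ _, fun h => lt_irrefl _ (mem_filter.mp h).2⟩
  · intro j hj B hB u hu w hw v huv hvw
    obtain ⟨A, hA, hall⟩ := htop u
    exact (hpos A hA).2 j hj B hB u hu w hw v (hall v) (hall u) (hrank _ _ huv) (hrank _ _ hvw)

end Blocks

section BlockStructure

lemma exists_fin_cover {α : Type*} [Nonempty α] (N : Finset α) {K : ℕ} (h : N.card ≤ K) :
    ∃ g : Fin K → α, ∀ x ∈ N, ∃ k, g k = x := by
  classical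
  refine ⟨fun k => if hk : (k : ℕ) < N.card then N.equivFin.symm ⟨k, hk⟩ else
    Classical.arbitrary α, fun x hx => ?_⟩
  refine ⟨⟨N.equivFin ⟨x, hx⟩, (N.equivFin ⟨x, hx⟩).2.trans_le h⟩, ?_⟩
  simp

variable [Fintype V] [DecidableEq V]

open Classical in
lemma card_touching_le {G : SimpleGraph V} {w d : ℕ} (hG : IsReg G d)
    {P : Finpartition (univ : Finset V)} {A : Finset V} (hA : A ∈ P.parts) (hw : redDeg G P A ≤ w) :
    (P.parts.filter fun B => ∃ u ∈ A, ∃ v ∈ B, G.Adj u v).card ≤ w + d + 1 := by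
  obtain ⟨a, ha⟩ := P.nonempty_of_mem_parts hA
  have hsub : (P.parts.filter fun B => ∃ u ∈ A, ∃ v ∈ B, G.Adj u v) ⊆
      insert A ((P.parts.filter fun B => B ≠ A ∧ (∃ u ∈ A, ∃ v ∈ B, G.Adj u v) ∧
        ¬ (∀ u ∈ A, ∀ v ∈ B, G.Adj u v)) ∪ (P.parts.filter fun B => ∃ v ∈ B, G.Adj a v)) := by
    intro B hB
    obtain ⟨hB1, hB2⟩ := mem_filter.mp hB
    rw [mem_insert, mem_union, mem_filter, mem_filter]
    by_cases hBA : B = A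
    · exact Or.inl hBA
    by_cases hfull : ∀ u ∈ A, ∀ v ∈ B, G.Adj u v
    · obtain ⟨v, hv⟩ := P.nonempty_of_mem_parts hB1
      exact Or.inr (Or.inr ⟨hB1, v, hv, hfull a ha v hv⟩)
    · exact Or.inr (Or.inl ⟨hB1, hBA, hB2, hfull⟩)
  have h1 : (P.parts.filter fun B => B ≠ A ∧ (∃ u ∈ A, ∃ v ∈ B, G.Adj u v) ∧
        ¬ (∀ u ∈ A, ∀ v ∈ B, G.Adj u v)).card ≤ w := by
    refine le_trans (le_of_eq ?_) hw
    rw [redDeg, Nat.card_eq_fintype_card, Fintype.card_subtype]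
    congr 1
    ext B
    simp
  have h2 : (P.parts.filter fun B => ∃ v ∈ B, G.Adj a v).card ≤ d := by
    rw [← hG a, deg_eq_degree, ← SimpleGraph.card_neighborFinset_eq_degree]
    have hx : ∀ B ∈ P.parts.filter fun B => ∃ v ∈ B, G.Adj a v, ∃ v ∈ B, G.Adj a v :=
      fun B hB => (mem_filter.mp hB).2
    have : Nonempty V := ⟨a⟩
    choose! f hf1 hf2 using hx
    refine card_le_card_of_injOn f (fun B hB => ?_) ?_
    · rw [mem_coe, SimpleGraph.mem_neighborFinset]
      exact hf2 B hB
    · intro B hB B' hB' h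
      have hm := hf1 B' hB'
      rw [← h] at hm
      exact P.eq_of_mem_parts (mem_filter.mp hB).1 (mem_filter.mp hB').1 (hf1 B hB) hm
  have h3 := card_le_card hsub
  have h4 := card_insert_le A ((P.parts.filter fun B => B ≠ A ∧ (∃ u ∈ A, ∃ v ∈ B, G.Adj u v) ∧
        ¬ (∀ u ∈ A, ∀ v ∈ B, G.Adj u v)) ∪ (P.parts.filter fun B => ∃ v ∈ B, G.Adj a v))
  have h5 := card_union_le (P.parts.filter fun B => B ≠ A ∧ (∃ u ∈ A, ∃ v ∈ B, G.Adj u v) ∧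
        ¬ (∀ u ∈ A, ∀ v ∈ B, G.Adj u v)) (P.parts.filter fun B => ∃ v ∈ B, G.Adj a v)
  omega

lemma IntervalOf.exists_ends {V : Type*} [DecidableEq V] {pos : V → ℕ}
    {β : Type*} [DecidableEq β] {b : V → β}
    (hb : ∀ u v w, pos u ≤ pos v → pos v ≤ pos w → b u = b w → b v = b w)
    {Y : Finset V} (hY : IntervalOf pos Y) (hne : Y.Nonempty) :
    ∃ E : Finset β, E.card ≤ 2 ∧ (∃ y ∈ Y, b y ∈ E) ∧
      ∀ v ∈ Y, b v ∉ E → ∀ u, b u = b v → u ∈ Y := by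
  obtain ⟨y₁, hy₁, hmin⟩ := exists_min_image Y pos hne
  obtain ⟨y₂, hy₂, hmax⟩ := exists_max_image Y pos hne
  refine ⟨{b y₁, b y₂}, card_le_two, ⟨y₁, hy₁, by simp⟩, fun v hv hvE u huv => ?_⟩
  rw [mem_insert, mem_singleton, not_or] at hvE
  by_contra huY
  rcases le_or_gt (pos y₁) (pos u) with h1 | h1
  · rcases le_or_gt (pos u) (pos y₂) with h2 | h2
    · exact huY (hY y₁ hy₁ y₂ hy₂ u h1 h2)
    · exact hvE.2 ((hb v y₂ u (hmax v hv) h2.le huv.symm).trans huv).symm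
  · exact hvE.1 (hb u y₁ v h1.le (hmin v hv) huv).symm

/-- All vertices in the block `x` of `b` lie in the same part of `P`. -/
def InOnePart {β : Type*} (b : V → β) (P : Finpartition (univ : Finset V)) (x : β) : Prop :=
  ∀ u v, b u = x → b v = x → ∃ A ∈ P.parts, u ∈ A ∧ v ∈ A

lemma exists_block_neighbours {β : Type*} [DecidableEq β] {G : SimpleGraph V} {w d n : ℕ}
    (hG : IsReg G d) (P : ℕ → Finpartition (univ : Finset V))
    (h0 : ∀ A ∈ (P 0).parts, A.card = 1) (hP : ∀ i < n, IsMergeStep (P i) (P (i + 1)))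
    (hn : (P n).parts.card ≤ 1) (hw : ∀ i ≤ n, ∀ A ∈ (P i).parts, redDeg G (P i) A ≤ w)
    {pos : V → ℕ} (hpos : ∀ j ≤ n, ∀ B ∈ (P j).parts, IntervalOf pos B) {b : V → β}
    (hb : ∀ u v w, pos u ≤ pos v → pos v ≤ pos w → b u = b w → b v = b w) :
    ∃ N : β → Finset β, (∀ x, (N x).card ≤ 2 * (w + d) + 4) ∧
      ∀ u v, G.Adj u v → b v ∈ N (b u) ∨ b u ∈ N (b v) := by
  classical
  have hex : ∀ x, ∃ k, InOnePart b (P k) x := by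
    refine fun x => ⟨n, fun u v _ _ => ?_⟩
    obtain ⟨A, hA, hu⟩ := (P n).exists_mem (mem_univ u)
    obtain ⟨B, hB, hv⟩ := (P n).exists_mem (mem_univ v)
    exact ⟨A, hA, hu, card_le_one.mp hn B hB A hA ▸ hv⟩
  let τ : β → ℕ := fun x => Nat.find (hex x)
  have hτn : ∀ x, τ x ≤ n := by
    refine fun x => Nat.find_min' (hex x) fun u v _ _ => ?_
    obtain ⟨A, hA, hu⟩ := (P n).exists_mem (mem_univ u)
    obtain ⟨B, hB, hv⟩ := (P n).exists_mem (mem_univ v)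
    exact ⟨A, hA, hu, card_le_one.mp hn B hB A hA ▸ hv⟩
  have hends : ∀ Y, ∃ E : Finset β, E.card ≤ 2 ∧ ((∃ j ≤ n, Y ∈ (P j).parts) →
      (∃ y ∈ Y, b y ∈ E) ∧ ∀ v ∈ Y, b v ∉ E → ∀ u, b u = b v → u ∈ Y) := by
    intro Y
    by_cases hY : ∃ j ≤ n, Y ∈ (P j).parts
    · obtain ⟨j, hj, hYj⟩ := hY
      obtain ⟨E, h1, h2⟩ := (hpos j hj Y hYj).exists_ends hb ((P j).nonempty_of_mem_parts hYj)
      exact ⟨E, h1, fun _ => h2⟩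
    · exact ⟨∅, by simp, fun h => absurd h hY⟩
  choose E hE2 hE using hends
  have hlast : ∀ k ≤ n, ∃ E' : Finset β, E'.card ≤ 2 ∧ ∀ Y ∈ (P k).parts, ∀ v ∈ Y, b v ∉ E Y →
      k ≤ τ (b v) → b v ∈ E' := by
    intro k hk
    cases k with
    | zero =>
      refine ⟨∅, by simp, fun Y hY v hv hvE _ => ?_⟩
      obtain ⟨y, hy, hyE⟩ := (hE Y ⟨0, hk, hY⟩).1
      rw [card_le_one.mp (h0 Y hY).le y hy v hv] at hyE
      exact absurd hyE hvE
    | succ k =>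
      obtain ⟨A, hA, B, hB, hAB, hQ⟩ := hP k (by omega)
      have hEA := (hE A ⟨k, by omega, hA⟩).2
      refine ⟨E A, hE2 A, fun Y hY v hv hvE hkτ => ?_⟩
      by_contra hvA
      have hnot : ¬ InOnePart b (P k) (b v) := Nat.find_min (hex (b v))
        (show k < τ (b v) by omega)
      have hcont : ∀ C ∈ (P k).parts, ¬ ∀ u, b u = b v → u ∈ C :=
        fun C hC h => hnot fun u u' hu hu' => ⟨C, hC, h u hu, h u' hu'⟩
      have hblock := (hE Y ⟨k + 1, hk, hY⟩).2 v hv hvE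
      rw [hQ, mem_insert, mem_erase, mem_erase] at hY
      rcases hY with rfl | hY
      · by_cases hu : ∃ u ∈ A, b u = b v
        · obtain ⟨u, huA, hu⟩ := hu
          refine hcont A hA fun u' hu' => hEA u huA (hu ▸ hvA) u' (hu'.trans hu.symm)
        · push Not at hu
          refine hcont B hB fun u' hu' => ?_
          rcases mem_union.mp (hblock u' hu') with h | h
          · exact absurd hu' (hu u' h)
          · exact h
      · exact hcont Y hY.2.2 hblock
  have hN : ∀ x, ∃ N : Finset β, N.card ≤ 2 * (w + d) + 4 ∧
      ∀ u v, b u = x → G.Adj u v → τ x ≤ τ (b v) → b v ∈ N := by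
    intro x
    by_cases hx : ∃ u, b u = x
    · obtain ⟨u₀, hu₀⟩ := hx
      obtain ⟨E', hE'2, hE'⟩ := hlast (τ x) (hτn x)
      obtain ⟨X, hX, hu₀X⟩ := (P (τ x)).exists_mem (mem_univ u₀)
      refine ⟨(((P (τ x)).parts.filter fun B => ∃ u ∈ X, ∃ v ∈ B, G.Adj u v).biUnion E) ∪ E',
        ?_, ?_⟩
      · refine (card_union_le _ _).trans ?_
        have h1 := card_touching_le hG hX (hw _ (hτn x) X hX)
        have h2 := card_biUnion_le_card_mul
          ((P (τ x)).parts.filter fun B => ∃ u ∈ X, ∃ v ∈ B, G.Adj u v) E 2 fun Y _ => hE2 Y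
        omega
      · intro u v hu huv hτ
        obtain ⟨A, hA, hu1, hu2⟩ := Nat.find_spec (hex x) u u₀ hu hu₀
        obtain rfl := (P (τ x)).eq_of_mem_parts hA hX hu2 hu₀X
        obtain ⟨Y, hY, hvY⟩ := (P (τ x)).exists_mem (mem_univ v)
        rw [mem_union, mem_biUnion]
        by_cases hvE : b v ∈ E Y
        · exact Or.inl ⟨Y, mem_filter.mpr ⟨hY, u, hu1, v, hvY, huv⟩, hvE⟩
        · exact Or.inr (hE' Y hY v hvY hvE hτ)
    · exact ⟨∅, by simp, fun u _ hu => absurd ⟨u, hu⟩ hx⟩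
  choose N hN1 hN2 using hN
  refine ⟨N, hN1, fun u v huv => ?_⟩
  rcases le_total (τ (b u)) (τ (b v)) with h | h
  · exact Or.inl (hN2 (b u) u v rfl huv h)
  · exact Or.inr (hN2 (b v) v u rfl huv.symm h)

/-- A regular graph of small twin-width is sparse between the blocks of some balanced partition. -/
theorem exists_block_structure {G : SimpleGraph V} {w d t : ℕ} (ht : 0 < t) (hG : IsReg G d)
    (hw : SeqOK G redDeg w) :
    ∃ (b : V → Fin (Fintype.card V / t + 1))
      (g : Fin (Fintype.card V / t + 1) → Fin (2 * (w + d) + 4) → Fin (Fintype.card V / t + 1)),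
      (∀ x, (univ.filter fun v => b v = x).card ≤ t) ∧
      ∀ u v, G.Adj u v → (∃ k, g (b u) k = b v) ∨ ∃ k, g (b v) k = b u := by
  obtain ⟨n, Q, hQ0, hQn, hQs, hQw⟩ := hw
  let P : ℕ → Finpartition (univ : Finset V) := fun i => Q (Fin.ofNat (n + 1) i)
  have hPi : ∀ i (hi : i < n + 1), P i = Q ⟨i, hi⟩ := by
    intro i hi
    simp only [P]
    congr 1
    exact Fin.ext (Nat.mod_eq_of_lt hi)
  have h0 : ∀ A ∈ (P 0).parts, A.card = 1 := hQ0
  have hs : ∀ i < n, IsMergeStep (P i) (P (i + 1)) := by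
    intro i hi
    rw [hPi i (by omega), hPi (i + 1) (by omega)]
    exact hQs ⟨i, hi⟩
  have hn : (P n).parts.card ≤ 1 := by
    rw [hPi n (by omega)]
    exact hQn
  obtain ⟨pos, hinj, hlt, hpos⟩ := exists_linear_pos P h0 n hs hn
  have hbl : ∀ v, pos v / t < Fintype.card V / t + 1 :=
    fun v => Nat.lt_succ_of_le (Nat.div_le_div_right (hlt v).le)
  obtain ⟨N, hN1, hN2⟩ := exists_block_neighbours (b := fun v => (⟨pos v / t, hbl v⟩ :
    Fin (Fintype.card V / t + 1))) hG P h0 hs hn (fun i _ => hQw _) hpos (by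
      intro u v w huv hvw h
      rw [Fin.mk.injEq] at h ⊢
      have h1 := Nat.div_le_div_right (c := t) huv
      have h2 := Nat.div_le_div_right (c := t) hvw
      omega)
  choose g hg using fun x => exists_fin_cover (N x) (hN1 x)
  refine ⟨fun v => ⟨pos v / t, hbl v⟩, g, fun x => ?_, fun u v huv => ?_⟩
  · calc _ ≤ (Ico (x * t) (x * t + t)).card := by
          refine card_le_card_of_injOn pos (fun v hv => ?_) hinj.injOn
          rw [mem_coe, mem_filter] at hv
          have hx : pos v / t = x := congrArg Fin.val hv.2
          rw [mem_coe, mem_Ico, ← hx]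
          have h1 := Nat.div_add_mod (pos v) t
          have h2 := Nat.mod_lt (pos v) ht
          rw [mul_comm] at h1
          omega
      _ = t := by simp
  · rcases hN2 u v huv with h | h
    · exact Or.inl (hg _ _ h)
    · exact Or.inr (hg _ _ h)

end BlockStructure

section Counting

section TwwAttained

variable [Fintype V] [DecidableEq V]

lemma exists_seqOK (G : SimpleGraph V) : ∃ w, SeqOK G redDeg w := by
  have h : Contracts G (Fintype.card V) (fiberPartition (id : V → V))
      (fiberPartition fun _ => ()) :=
    contracts_fiberPartition G _ _ _ (fun _ _ _ => rfl) fun _ =>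
      ⟨univ, le_rfl, fun _ _ _ _ => mem_univ _⟩
  exact ⟨_, h.seqOK (fun A => card_eq_one_of_mem_fiberPartition_id)
    (redDegLE_of_card_eq_one G _ _ fun A => card_eq_one_of_mem_fiberPartition_id)
    (card_fiberPartition_le_one _ fun _ _ => rfl)⟩

lemma seqOK_of_tww_le {G : SimpleGraph V} {w : ℕ} (h : tww G ≤ w) : SeqOK G redDeg w := by
  obtain ⟨n, P, h0, hn, hs, hw⟩ : SeqOK G redDeg (tww G) := Nat.sInf_mem (exists_seqOK G)
  exact ⟨n, P, h0, hn, hs, fun i A hA => (hw i A hA).trans h⟩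

end TwwAttained

lemma IsReg.card_edgeFinset [Fintype V] {G : SimpleGraph V} {d : ℕ} (hG : IsReg G d)
    [Fintype G.edgeSet] : 2 * G.edgeFinset.card = Fintype.card V * d := by
  classical
  have h := G.sum_degrees_eq_twice_card_edges
  rw [sum_congr rfl fun v _ => ((deg_eq_degree G v).symm.trans (hG v)), sum_const, card_univ,
    smul_eq_mul] at h
  rw [h]
  congr!

open Classical in
lemma card_regular_between_blocks_le [Fintype V] {m h t d : ℕ} (b : V → Fin m)
    (hb : ∀ x, (univ.filter fun v => b v = x).card ≤ t) (g : Fin m → Fin h → Fin m) :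
    (univ.filter fun G : SimpleGraph V => IsReg G d ∧
      ∀ u v, G.Adj u v → (∃ k, g (b u) k = b v) ∨ ∃ k, g (b v) k = b u).card ≤
      (m * h * t ^ 2).choose (Fintype.card V * d / 2) := by
  set T : Finset (V × V) := (univ : Finset (Fin m × Fin h)).biUnion fun p =>
    (univ.filter fun v => b v = p.1) ×ˢ (univ.filter fun v => b v = g p.1 p.2) with hT
  have hTcard : T.card ≤ m * h * t ^ 2 := by
    refine (card_biUnion_le_card_mul _ _ (t ^ 2) fun p _ => ?_).trans ?_
    · rw [card_product, sq]
      exact Nat.mul_le_mul (hb _) (hb _)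
    · simp
  set S : Finset (Sym2 V) := T.image fun p => s(p.1, p.2) with hS
  calc _ ≤ (powersetCard (Fintype.card V * d / 2) S).card := by
        refine card_le_card_of_injOn (fun G => G.edgeFinset) (fun G hG => ?_) ?_
        · rw [mem_coe, mem_filter] at hG
          obtain ⟨-, hreg, hadj⟩ := hG
          rw [mem_coe, mem_powersetCard]
          refine ⟨fun e he => ?_, ?_⟩
          swap
          · rw [← hreg.card_edgeFinset, Nat.mul_div_cancel_left _ two_pos]
          rw [SimpleGraph.mem_edgeFinset] at he
          induction e with
          | _ u v =>
            rw [SimpleGraph.mem_edgeSet] at he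
            rw [hS, mem_image]
            rcases hadj u v he with ⟨k, hk⟩ | ⟨k, hk⟩
            · refine ⟨(u, v), ?_, rfl⟩
              rw [hT, mem_biUnion]
              exact ⟨(b u, k), mem_univ _, by simp [hk]⟩
            · refine ⟨(v, u), ?_, Sym2.eq_swap⟩
              rw [hT, mem_biUnion]
              exact ⟨(b v, k), mem_univ _, by simp [hk]⟩
        · intro G _ G' _ h
          exact SimpleGraph.edgeFinset_inj.mp h
    _ = S.card.choose _ := card_powersetCard _ _
    _ ≤ _ := Nat.choose_le_choose _ (card_image_le.trans hTcard)

lemma card_regular_tww_le_of_fintype [Fintype V] [DecidableEq V] {d w t : ℕ} (ht : 0 < t)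
    {m h : ℕ} (hm : m = Fintype.card V / t + 1) (hh : h = 2 * (w + d) + 4) :
    Nat.card {G : SimpleGraph V // IsReg G d ∧ tww G ≤ w} ≤
      m ^ Fintype.card V * m ^ (m * h) *
        (m * h * t ^ 2).choose (Fintype.card V * d / 2) := by
  classical
  rw [Nat.card_eq_fintype_card, Fintype.card_subtype]
  have hsub : (univ.filter fun G : SimpleGraph V => IsReg G d ∧ tww G ≤ w) ⊆
      (univ.filter fun p : (V → Fin m) × (Fin m → Fin h → Fin m) =>
        ∀ x, (univ.filter fun v => p.1 v = x).card ≤ t).biUnion fun p =>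
      univ.filter fun G : SimpleGraph V => IsReg G d ∧
      ∀ u v, G.Adj u v → (∃ k, p.2 (p.1 u) k = p.1 v) ∨ ∃ k, p.2 (p.1 v) k = p.1 u := by
    intro G hG
    obtain ⟨-, hG, hw⟩ := mem_filter.mp hG
    subst hm hh
    obtain ⟨b, g, h1, h2⟩ := exists_block_structure ht hG (seqOK_of_tww_le hw)
    exact mem_biUnion.mpr ⟨(b, g), mem_filter.mpr ⟨mem_univ _, h1⟩,
      mem_filter.mpr ⟨mem_univ _, hG, h2⟩⟩
  refine (card_le_card hsub).trans ((card_biUnion_le_card_mul _ _ _ fun p hp => ?_).trans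
    (Nat.mul_le_mul_right _ ((card_le_univ _).trans (le_of_eq ?_))))
  · convert card_regular_between_blocks_le (d := d) p.1 (mem_filter.mp hp).2 p.2
  · simp only [Fintype.card_prod, Fintype.card_fun, Fintype.card_fin]
    rw [← pow_mul, mul_comm h]

/-- There are few regular graphs of small twin-width. -/
theorem card_regular_tww_le {n d w t : ℕ} (ht : 0 < t) :
    Nat.card {G : SimpleGraph (Fin n) // IsReg G d ∧ tww G ≤ w} ≤
      (n / t + 1) ^ n * (n / t + 1) ^ ((n / t + 1) * (2 * (w + d) + 4)) *
        ((n / t + 1) * (2 * (w + d) + 4) * t ^ 2).choose (n * d / 2) := by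
  have := card_regular_tww_le_of_fintype (V := Fin n) (d := d) (w := w) ht rfl rfl
  rwa [Fintype.card_fin] at this

end Counting

section RegularConstruction

/-- Perfect matchings given by permutations between `d` blocks and `d` further blocks of size
`s`, together with `j` disjoint cliques on `d + 1` vertices. -/
def matchingsGraph (d s j : ℕ) (σ : Fin d → Fin d → Equiv.Perm (Fin s)) :
    SimpleGraph (((Fin d × Fin s) ⊕ (Fin d × Fin s)) ⊕ (Fin j × Fin (d + 1))) where
  Adj
    | .inl (.inl p), .inl (.inr q) => σ p.1 q.1 p.2 = q.2
    | .inl (.inr q), .inl (.inl p) => σ p.1 q.1 p.2 = q.2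
    | .inr a, .inr b => a.1 = b.1 ∧ a.2 ≠ b.2
    | _, _ => False
  symm := ⟨by
    rintro ((p | p) | p) ((q | q) | q) h <;> first | exact h | exact ⟨h.1.symm, h.2.symm⟩⟩
  loopless := ⟨by rintro ((p | p) | p) h <;> simp at h⟩

lemma deg_eq_of_enum {G : SimpleGraph V} {v : V} {d : ℕ} (f : Fin d → V)
    (hf : Function.Injective f) (h : ∀ u, G.Adj v u ↔ ∃ i, f i = u) : deg G v = d := by
  have : G.neighborSet v = Set.range f := Set.ext fun u => h u
  rw [deg, this, Nat.card_range_of_injective hf, Nat.card_fin]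

lemma isReg_matchingsGraph (d s j : ℕ) (σ : Fin d → Fin d → Equiv.Perm (Fin s)) :
    IsReg (matchingsGraph d s j σ) d := by
  rintro ((⟨i, x⟩ | ⟨i, x⟩) | ⟨i, x⟩)
  · refine deg_eq_of_enum (fun k => .inl (.inr (k, σ i k x))) (fun k l h => by simp at h; exact h.1)
      ?_
    rintro ((⟨k, y⟩ | ⟨k, y⟩) | ⟨k, y⟩) <;> simp [matchingsGraph]
  · refine deg_eq_of_enum (fun k => .inl (.inl (k, (σ k i).symm x)))
      (fun k l h => by simp at h; exact h.1) ?_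
    rintro ((⟨k, y⟩ | ⟨k, y⟩) | ⟨k, y⟩) <;> simp [matchingsGraph, Equiv.symm_apply_eq, eq_comm (a := x)]
  · refine deg_eq_of_enum (fun k => .inr (i, x.succAbove k))
      (fun k l h => by simpa using h) ?_
    rintro ((⟨k, y⟩ | ⟨k, y⟩) | ⟨k, y⟩) <;>
      simp [matchingsGraph, Fin.exists_succAbove_eq_iff, eq_comm (a := x)]

lemma matchingsGraph_injective (d s j : ℕ) : Function.Injective (matchingsGraph d s j) := by
  intro σ τ h
  funext i k
  ext x : 1
  have : (matchingsGraph d s j τ).Adj (.inl (.inl (i, x))) (.inl (.inr (k, σ i k x))) := by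
    rw [← h]
    rfl
  exact Eq.symm this

lemma IsReg.comap {W : Type*} {G : SimpleGraph W} {d : ℕ} (hG : IsReg G d) (e : V ≃ W) :
    IsReg (G.comap e) d := fun v => by
  rw [← hG (e v)]
  exact Nat.card_congr ((SimpleGraph.Iso.comap e G).mapNeighborSet v)

lemma factorial_pow_le_card_regular {n d s j : ℕ} (hn : n = 2 * d * s + j * (d + 1)) :
    s.factorial ^ (d * d) ≤ Nat.card {G : SimpleGraph (Fin n) // IsReg G d} := by
  have e : Fin n ≃ ((Fin d × Fin s) ⊕ (Fin d × Fin s)) ⊕ (Fin j × Fin (d + 1)) := by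
    refine Fintype.equivOfCardEq ?_
    simp only [Fintype.card_sum, Fintype.card_prod, Fintype.card_fin]
    rw [hn]
    ring
  have hcard : Nat.card (Fin d → Fin d → Equiv.Perm (Fin s)) = s.factorial ^ (d * d) := by
    simp [Nat.card_eq_fintype_card, Fintype.card_perm, pow_mul]
  rw [← hcard]
  refine Nat.card_le_card_of_injective
    (fun σ => ⟨(matchingsGraph d s j σ).comap e, (isReg_matchingsGraph d s j σ).comap e⟩) ?_
  intro σ τ h
  refine matchingsGraph_injective d s j (SimpleGraph.ext ?_)
  funext u v
  have := congrArg (fun G => G.1.Adj (e.symm u) (e.symm v)) h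
  simpa using this

lemma exists_decomposition {d n : ℕ} (hd : 0 < d) (heven : Even (n * d))
    (hn : 2 * d * (d + 1) ≤ n) :
    ∃ s j, n = 2 * d * s + j * (d + 1) ∧ j < 2 * d := by
  set j := (d + 1) * n % (2 * d) with hj
  have hjlt : j < 2 * d := Nat.mod_lt _ (by positivity)
  have hle : j * (d + 1) ≤ n := (Nat.mul_le_mul_right _ hjlt.le).trans hn
  have hmod : j * (d + 1) ≡ n [MOD 2 * d] := by
    have h1 : j * (d + 1) ≡ (d + 1) * n * (d + 1) [MOD 2 * d] := (Nat.mod_modEq _ _).mul_right _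
    refine h1.trans ?_
    obtain ⟨c, hc⟩ := heven
    have h2 : (d + 1) * n * (d + 1) = n + 2 * d * (c + n) := by
      calc (d + 1) * n * (d + 1) = d * (n * d) + 2 * d * n + n := by ring
        _ = _ := by rw [hc]; ring
    rw [h2]
    exact (Nat.add_modEq_left_iff.mpr ⟨_, rfl⟩)
  obtain ⟨s, hs⟩ := (Nat.modEq_iff_dvd' hle).mp hmod
  exact ⟨s, j, by omega, hjlt⟩

lemma IsReg.even {n d : ℕ} {G : SimpleGraph (Fin n)} (hG : IsReg G d) : Even (n * d) := by
  classical
  have := hG.card_edgeFinset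
  rw [Fintype.card_fin] at this
  exact ⟨_, by rw [← this, two_mul]⟩

lemma mul_log_sub_le_log_factorial (s : ℕ) :
    (s : ℝ) * Real.log s - s ≤ Real.log s.factorial := by
  rcases Nat.eq_zero_or_pos s with rfl | hs
  · simp
  have h := Stirling.le_log_factorial_stirling hs.ne'
  have h1 : 0 ≤ Real.log s := Real.log_natCast_nonneg s
  have h2 : 0 ≤ Real.log (2 * Real.pi) := Real.log_nonneg (by linarith [Real.pi_gt_three])
  linarith

theorem exists_exp_le_card_regular {d : ℕ} (hd : 0 < d) :
    ∃ C : ℝ, ∃ N : ℕ, ∀ n : ℕ, N ≤ n → Even (n * d) →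
      Real.exp ((d : ℝ) / 2 * (n * Real.log n) - C * n) ≤
        Nat.card {G : SimpleGraph (Fin n) // IsReg G d} := by
  refine ⟨(d : ℝ) ^ 2 * ((d + 1) + Real.log (4 * d) + 1), 4 * d * (d + 1), fun n hn heven => ?_⟩
  obtain ⟨s, j, hnsj, hj⟩ := exists_decomposition hd heven (by nlinarith)
  have hd' : (1 : ℝ) ≤ d := by exact_mod_cast hd
  have hnR : 4 * (d : ℝ) * (d + 1) ≤ n := by exact_mod_cast hn
  have hn0 : (0 : ℝ) < n := lt_of_lt_of_le (by positivity) hnR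
  have hnsjR : (n : ℝ) = 2 * d * s + j * (d + 1) := by exact_mod_cast hnsj
  have hjR : (j : ℝ) ≤ 2 * d := by exact_mod_cast hj.le
  have hs1 : (n : ℝ) / (2 * d) - (d + 1) ≤ s := by
    rw [sub_le_iff_le_add, div_le_iff₀ (by positivity)]
    nlinarith
  have hs2 : (n : ℝ) / (4 * d) ≤ s := by
    refine le_trans ?_ hs1
    have : (d : ℝ) + 1 ≤ n / (4 * d) := by
      rw [le_div_iff₀ (by positivity)]
      linarith
    have h2 : (n : ℝ) / (2 * d) = n / (4 * d) + n / (4 * d) := by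
      field_simp
      norm_num
    linarith
  have hs0 : (0 : ℝ) < s := lt_of_lt_of_le (by positivity) hs2
  have hsn : (s : ℝ) ≤ n := by
    have : (0 : ℝ) ≤ j * (d + 1) := by positivity
    nlinarith
  have hlog : Real.log n - Real.log (4 * d) ≤ Real.log s := by
    rw [← Real.log_div hn0.ne' (by positivity)]
    exact Real.log_le_log (by positivity) hs2
  have hlog0 : 0 ≤ Real.log n - Real.log (4 * d) :=
    sub_nonneg.mpr (Real.log_le_log (by positivity) (by nlinarith))
  have hlog4 : 0 ≤ Real.log (4 * d) := Real.log_nonneg (by linarith)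
  have hlogn : Real.log n ≤ n := (Real.log_le_sub_one_of_pos hn0).trans (by linarith)
  have hmul : ((n : ℝ) / (2 * d) - (d + 1)) * (Real.log n - Real.log (4 * d)) ≤ s * Real.log s :=
    mul_le_mul hs1 hlog hlog0 hs0.le
  have hquot : (n : ℝ) / (2 * d) * Real.log (4 * d) ≤ n * Real.log (4 * d) :=
    mul_le_mul_of_nonneg_right (div_le_self hn0.le (by linarith)) hlog4
  have hmain : (n : ℝ) / (2 * d) * Real.log n - ((d + 1) + Real.log (4 * d) + 1) * n ≤
      Real.log s.factorial := by
    have := mul_log_sub_le_log_factorial s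
    nlinarith
  have hfac : (0 : ℝ) < s.factorial := by exact_mod_cast s.factorial_pos
  calc Real.exp _ ≤ Real.exp (((d * d : ℕ) : ℝ) * Real.log s.factorial) := by
        refine Real.exp_le_exp.mpr ?_
        have h := mul_le_mul_of_nonneg_left hmain (sq_nonneg (d : ℝ))
        have e : (d : ℝ) ^ 2 * (n / (2 * d) * Real.log n) = d / 2 * (n * Real.log n) := by
          field_simp
        push_cast
        nlinarith
    _ = ((s.factorial ^ (d * d) : ℕ) : ℝ) := by
        rw [Real.exp_nat_mul, Real.exp_log hfac, Nat.cast_pow]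
    _ ≤ _ := by exact_mod_cast factorial_pow_le_card_regular hnsj

end RegularConstruction

section CountingAsymptotics

lemma choose_le_exp {M K n : ℕ} (hM : 0 < M) (hn : 0 < n) (hnK : n ≤ K) :
    (M.choose K : ℝ) ≤ Real.exp (K * (Real.log (M / n) + 1)) := by
  have hM' : (0 : ℝ) < M := by exact_mod_cast hM
  have hn' : (0 : ℝ) < n := by exact_mod_cast hn
  have hlog : Real.log n ≤ Real.log K := Real.log_le_log hn' (by exact_mod_cast hnK)
  have hK : (0 : ℝ) ≤ K := K.cast_nonneg
  have hfac : (0 : ℝ) < K.factorial := by exact_mod_cast K.factorial_pos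
  calc (M.choose K : ℝ) ≤ (M : ℝ) ^ K / K.factorial := Nat.choose_le_pow_div K M
    _ = Real.exp (K * Real.log M - Real.log K.factorial) := by
        rw [Real.exp_sub, Real.exp_log hfac, Real.exp_nat_mul, Real.exp_log hM']
    _ ≤ _ := Real.exp_le_exp.mpr ?_
  rw [Real.log_div hM'.ne' hn'.ne']
  have := mul_log_sub_le_log_factorial K
  nlinarith

/-- The number of regular graphs of twin-width at most `n ^ δ`, on a logarithmic scale. -/
theorem exists_card_regular_tww_le_exp {d : ℕ} (hd : 2 ≤ d) {τ δ : ℝ} (hδ : 0 ≤ δ) (hδτ : δ < τ)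
    (hτ : τ ≤ 1) : ∃ C : ℝ, ∀ n : ℕ, 0 < n → Even (n * d) →
      (Nat.card {G : SimpleGraph (Fin n) // IsReg G d ∧ (tww G : ℝ) ≤ (n : ℝ) ^ δ} : ℝ) ≤
        Real.exp ((1 - τ + (d : ℝ) / 2 * (τ + δ)) * (n * Real.log n) + C * n) := by
  set η := τ - δ with hη
  have hη0 : 0 < η := sub_pos.mpr hδτ
  set A : ℝ := 2 * d + 6 with hA
  have hA0 : 0 < A := by positivity
  refine ⟨Real.log 2 + 2 * A * (1 + 1 / η) + (d : ℝ) / 2 * (Real.log (4 * A) + 1),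
    fun n hn heven => ?_⟩
  have hn1 : (1 : ℝ) ≤ n := by exact_mod_cast hn
  have hn0 : (0 : ℝ) < n := by linarith
  have hL : 0 ≤ Real.log n := Real.log_natCast_nonneg n
  have hrp : ∀ x : ℝ, 0 < (n : ℝ) ^ x := fun x => Real.rpow_pos_of_pos hn0 x
  have hr1 : ∀ x : ℝ, 0 ≤ x → 1 ≤ (n : ℝ) ^ x := fun x hx => Real.one_le_rpow hn1 hx
  set w : ℕ := ⌊(n : ℝ) ^ δ⌋₊ with hw
  set t : ℕ := ⌈(n : ℝ) ^ τ⌉₊ with ht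
  have ht1 : (n : ℝ) ^ τ ≤ t := Nat.le_ceil _
  have ht2 : (t : ℝ) ≤ 2 * (n : ℝ) ^ τ := by
    have := Nat.ceil_lt_add_one (hrp τ).le
    have := hr1 τ (by linarith)
    linarith
  have ht0 : 0 < t := by
    have : (0 : ℝ) < t := (hrp τ).trans_le ht1
    exact_mod_cast this
  have ht0' : (0 : ℝ) < t := by exact_mod_cast ht0
  have htn : (t : ℝ) ≤ n := by
    have : t ≤ n := Nat.ceil_le.mpr (Real.rpow_le_self_of_one_le hn1 hτ)
    exact_mod_cast this
  have hw' : (w : ℝ) ≤ (n : ℝ) ^ δ := Nat.floor_le (hrp δ).le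
  set m : ℕ := n / t + 1 with hm
  set h : ℕ := 2 * (w + d) + 4 with hh
  have hmt : (m : ℝ) * t ≤ 2 * n := by
    have : m * t ≤ n + t := by
      rw [hm, add_mul, one_mul]
      exact Nat.add_le_add_right (Nat.div_mul_le_self _ _) _
    have : (m : ℝ) * t ≤ n + t := by exact_mod_cast this
    linarith
  have hm1 : (1 : ℝ) ≤ m := by exact_mod_cast Nat.succ_pos _
  have hm2 : (m : ℝ) ≤ 2 * (n : ℝ) ^ (1 - τ) := by
    rw [Real.rpow_sub hn0, Real.rpow_one, mul_div_assoc', le_div_iff₀ (hrp τ)]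
    exact (mul_le_mul_of_nonneg_left ht1 (by linarith)).trans hmt
  have hh0 : (0 : ℝ) < h := by exact_mod_cast Nat.succ_pos _
  have hh2 : (h : ℝ) ≤ A * (n : ℝ) ^ δ := by
    have := hr1 δ hδ
    have : (d : ℝ) ≤ d * (n : ℝ) ^ δ := le_mul_of_one_le_right d.cast_nonneg this
    rw [hh, hA]
    push_cast
    linarith
  have hlogm : Real.log m ≤ Real.log 2 + (1 - τ) * Real.log n := by
    rw [← Real.log_rpow hn0, ← Real.log_mul two_ne_zero (hrp _).ne']
    exact Real.log_le_log (by linarith) hm2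
  have hlogm0 : 0 ≤ Real.log m := Real.log_nonneg hm1
  have hlogm' : Real.log m ≤ (1 + 1 / η) * (n : ℝ) ^ η := by
    have h1 := Real.log_le_rpow_div hn0.le hη0
    have h2 := hr1 η hη0.le
    have h3 : Real.log 2 ≤ 1 := by linarith [Real.log_two_lt_d9]
    have h4 : (1 - τ) * Real.log n ≤ Real.log n := by nlinarith
    rw [add_mul, one_mul, one_div_mul_eq_div]
    linarith
  have hmh : (m : ℝ) * h * Real.log m ≤ 2 * A * (1 + 1 / η) * n := by
    calc (m : ℝ) * h * Real.log m
        ≤ (2 * (n : ℝ) ^ (1 - τ)) * (A * (n : ℝ) ^ δ) * ((1 + 1 / η) * (n : ℝ) ^ η) := by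
          gcongr
      _ = 2 * A * (1 + 1 / η) * ((n : ℝ) ^ (1 - τ) * (n : ℝ) ^ δ * (n : ℝ) ^ η) := by ring
      _ = _ := by
          rw [← Real.rpow_add hn0, ← Real.rpow_add hn0]
          have : 1 - τ + δ + η = 1 := by rw [hη]; ring
          rw [this, Real.rpow_one]
  set M : ℕ := m * h * t ^ 2 with hM
  have hM0 : 0 < M := by positivity
  have hMn : (M : ℝ) / n ≤ 4 * A * (n : ℝ) ^ (τ + δ) := by
    rw [div_le_iff₀ hn0, Real.rpow_add hn0]
    calc (M : ℝ) = (m * t) * h * t := by rw [hM]; push_cast; ring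
      _ ≤ (2 * n) * (A * (n : ℝ) ^ δ) * (2 * (n : ℝ) ^ τ) := by gcongr
      _ = _ := by ring
  have hlogM : Real.log (M / n) ≤ Real.log (4 * A) + (τ + δ) * Real.log n := by
    rw [← Real.log_rpow hn0, ← Real.log_mul (by positivity) (hrp _).ne']
    exact Real.log_le_log (by positivity) hMn
  obtain ⟨K, hK⟩ := heven
  have hKdiv : n * d / 2 = K := by omega
  have hnK : n ≤ K := by nlinarith
  have hKR : (K : ℝ) = d / 2 * n := by
    have : (n : ℝ) * d = K + K := by exact_mod_cast hK
    linarith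
  have hpow : ∀ k : ℕ, ((m ^ k : ℕ) : ℝ) = Real.exp (k * Real.log m) := fun k => by
    rw [Real.exp_nat_mul, Real.exp_log (by linarith), Nat.cast_pow]
  have hcount : Nat.card {G : SimpleGraph (Fin n) // IsReg G d ∧ (tww G : ℝ) ≤ (n : ℝ) ^ δ} ≤
      m ^ n * m ^ (m * h) * M.choose K := by
    have := card_regular_tww_le (n := n) (d := d) (w := w) ht0
    rw [hKdiv] at this
    refine le_trans (Nat.card_le_card_of_injective
      (fun G => ⟨G.1, G.2.1, Nat.le_floor G.2.2⟩) fun G G' hGG => ?_) this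
    exact Subtype.ext (congrArg (fun G => G.1) hGG)
  calc _ ≤ ((m ^ n * m ^ (m * h) * M.choose K : ℕ) : ℝ) := by exact_mod_cast hcount
    _ ≤ Real.exp (n * Real.log m) * Real.exp ((m * h : ℕ) * Real.log m) *
        Real.exp (K * (Real.log (M / n) + 1)) := by
        rw [Nat.cast_mul, Nat.cast_mul, hpow, hpow]
        exact mul_le_mul_of_nonneg_left (choose_le_exp hM0 hn hnK) (by positivity)
    _ ≤ _ := by
        rw [← Real.exp_add, ← Real.exp_add]
        refine Real.exp_le_exp.mpr ?_
        have h1 := mul_le_mul_of_nonneg_left hlogm hn0.le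
        have h2 := mul_le_mul_of_nonneg_left (add_le_add_left hlogM 1) (by positivity : (0 : ℝ) ≤ d / 2 * n)
        rw [hKR]
        push_cast
        linarith

end CountingAsymptotics

section TwinWidthZero

variable [Fintype V] [DecidableEq V]

/-- The vertex set `X` is a union of connected components of `G`. -/
def IsAdjClosed (G : SimpleGraph V) (X : Finset V) : Prop :=
  ∀ u ∈ X, ∀ v, G.Adj u v → v ∈ X

lemma isAdjClosed_or_card_le_of_redDeg_eq_zero {G : SimpleGraph V} {d : ℕ} (hG : IsReg G d)
    {P : Finpartition (univ : Finset V)} {A : Finset V}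
    (h : redDeg G P A = 0) : IsAdjClosed G A ∨ A.card ≤ d := by
  classical
  by_contra! hcon
  obtain ⟨hcl, hcard⟩ := hcon
  simp only [IsAdjClosed, not_forall] at hcl
  obtain ⟨u, hu, v, huv, hv⟩ := hcl
  obtain ⟨B, hB, hvB⟩ := P.exists_mem (mem_univ v)
  have hfull : ∀ u ∈ A, ∀ v ∈ B, G.Adj u v := by
    by_contra hnot
    rw [redDeg, Nat.card_eq_zero] at h
    rcases h with h | h
    · exact h.false ⟨B, hB, fun hBA => hv (hBA ▸ hvB), ⟨u, hu, v, hvB, huv⟩, hnot⟩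
    · exact not_finite {B : Finset V // B ∈ P.parts ∧ B ≠ A ∧
        (∃ u ∈ A, ∃ v ∈ B, G.Adj u v) ∧ ¬ ∀ u ∈ A, ∀ v ∈ B, G.Adj u v}
  have hsub : A ⊆ G.neighborFinset v := fun a ha => by
    rw [SimpleGraph.mem_neighborFinset]
    exact (hfull a ha v hvB).symm
  have := card_le_card hsub
  rw [SimpleGraph.card_neighborFinset_eq_degree, ← deg_eq_degree, hG v] at this
  omega

lemma IsAdjClosed.of_union {V : Type*} [DecidableEq V]
    {G : SimpleGraph V} {A B : Finset V} (h : IsAdjClosed G (A ∪ B))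
    (hB : IsAdjClosed G B) (hAB : Disjoint A B) : IsAdjClosed G A := fun u hu v huv => by
  rcases mem_union.mp (h u (mem_union_left _ hu) v huv) with hv | hv
  · exact hv
  · exact absurd (hB v hv u huv.symm) (disjoint_left.mp hAB hu)

/-- Regular graphs of twin-width zero have small connected components. -/
theorem exists_isAdjClosed_of_tww_eq_zero {G : SimpleGraph V} {d : ℕ} (hd : 0 < d)
    (hG : IsReg G d) (hw : SeqOK G redDeg 0) (v : V) :
    ∃ X : Finset V, v ∈ X ∧ X.card ≤ 2 * d ∧ IsAdjClosed G X := by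
  obtain ⟨n, P, h0, hn, hs, hred⟩ := hw
  by_contra! hX
  have key : ∀ i, ∀ A ∈ (P i).parts, v ∈ A → A.card ≤ d := by
    intro i
    induction i using Fin.induction with
    | zero => exact fun A hA _ => (h0 A hA).le.trans hd
    | succ i ih =>
      obtain ⟨A, hA, B, hB, hAB, hQ⟩ := hs i
      intro D hD hvD
      have hdisj := (P i.castSucc).disjoint hA hB hAB
      have merged : ∀ A ∈ (P i.castSucc).parts, ∀ B ∈ (P i.castSucc).parts, Disjoint A B →
          A ∪ B ∈ (P i.succ).parts → v ∈ A → (A ∪ B).card ≤ d := by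
        intro A hA B hB hdisj hAB hvA
        have hAd := ih A hA hvA
        have hc := card_union_of_disjoint hdisj
        rcases isAdjClosed_or_card_le_of_redDeg_eq_zero hG
          (Nat.le_zero.mp (hred i.succ _ hAB)) with hcl | hle
        · rcases isAdjClosed_or_card_le_of_redDeg_eq_zero hG
            (Nat.le_zero.mp (hred i.castSucc _ hB)) with hcl' | hle'
          · exact absurd (hcl.of_union hcl' hdisj) (hX A hvA (by omega))
          · exact absurd hcl (hX _ (mem_union_left _ hvA) (by omega))
        · exact hle
      have hmem : A ∪ B ∈ (P i.succ).parts := by rw [hQ]; exact mem_insert_self _ _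
      rw [hQ, mem_insert] at hD
      rcases hD with rfl | hD
      · rcases mem_union.mp hvD with hv | hv
        · exact merged A hA B hB hdisj hmem hv
        · rw [union_comm] at hmem ⊢
          exact merged B hB A hA hdisj.symm hmem hv
      · exact ih D (mem_of_mem_erase (mem_of_mem_erase hD)) hvD
  obtain ⟨A, hA, hvA⟩ := (P (Fin.last n)).exists_mem (mem_univ v)
  have hAuniv : ∀ u, u ∈ A := fun u => by
    obtain ⟨B, hB, huB⟩ := (P (Fin.last n)).exists_mem (mem_univ u)
    rwa [card_le_one.mp hn A hA B hB]
  exact hX A hvA ((key _ A hA hvA).trans (by omega)) fun _ _ u _ => hAuniv u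

end TwinWidthZero

section SmallComponents

open Classical in
lemma card_moving_le_pow [Fintype V] [DecidableEq V] (k : ℕ) (hV : 0 < Fintype.card V) :
    (univ.filter fun r : V → V => (univ.filter fun v => r v ≠ v).card ≤ k).card ≤
      2 ^ Fintype.card V * Fintype.card V ^ k := by
  have hsub : (univ.filter fun r : V → V => (univ.filter fun v => r v ≠ v).card ≤ k) ⊆
      ((univ : Finset (Finset V)).filter fun S => S.card ≤ k).biUnion fun S =>
        Fintype.piFinset fun v => if v ∈ S then univ else {v} := by
    intro r hr
    refine mem_biUnion.mpr ⟨_, mem_filter.mpr ⟨mem_univ _, (mem_filter.mp hr).2⟩, ?_⟩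
    rw [Fintype.mem_piFinset]
    intro v
    by_cases hv : r v = v <;> simp [hv]
  refine (card_le_card hsub).trans ((card_biUnion_le_card_mul _ _ (Fintype.card V ^ k)
    fun S hS => ?_).trans (Nat.mul_le_mul_right _ ((card_le_univ _).trans (by simp))))
  rw [Fintype.card_piFinset]
  have : ∀ v, (if v ∈ S then (univ : Finset V) else {v}).card =
      if v ∈ S then Fintype.card V else 1 := fun v => by split_ifs <;> simp
  rw [prod_congr rfl fun v _ => this v, prod_ite]
  simp only [prod_const, one_pow, mul_one, filter_univ_mem]
  exact Nat.pow_le_pow_right hV (mem_filter.mp hS).2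

open Classical in
lemma card_within_fibers_le [Fintype V] {c : ℕ} (r : V → V)
    (hr : ∀ v, (univ.filter fun u => r u = r v).card ≤ c) :
    (univ.filter fun G : SimpleGraph V => ∀ u v, G.Adj u v → r u = r v).card ≤
      (2 ^ c) ^ Fintype.card V := by
  calc _ ≤ (Fintype.piFinset fun v => (univ.filter fun u => r u = r v).powerset).card := by
        refine card_le_card_of_injOn (fun G v => G.neighborFinset v) (fun G hG => ?_) ?_
        · rw [mem_coe, mem_filter] at hG
          rw [mem_coe, Fintype.mem_piFinset]
          intro v
          rw [mem_powerset]
          intro u hu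
          rw [SimpleGraph.mem_neighborFinset] at hu
          exact mem_filter.mpr ⟨mem_univ _, (hG.2 v u hu).symm⟩
        · intro G _ G' _ h
          ext u v
          have := congrArg (v ∈ ·) (congrFun h u)
          simpa [SimpleGraph.mem_neighborFinset] using this
    _ ≤ _ := by
        rw [Fintype.card_piFinset]
        refine (prod_le_pow_card _ _ (2 ^ c) fun v _ => ?_).trans (by simp)
        rw [card_powerset]
        exact Nat.pow_le_pow_right two_pos (hr v)

open Classical in
/-- There are few graphs all of whose connected components have at most `c` vertices. -/
lemma card_small_components_le [Fintype V] (c : ℕ) (hV : 0 < Fintype.card V) :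
    Nat.card {G : SimpleGraph V // ∀ v, ∃ X : Finset V, v ∈ X ∧ X.card ≤ c ∧ IsAdjClosed G X} ≤
      2 ^ Fintype.card V * Fintype.card V ^ (Fintype.card V - Fintype.card V / c) *
        (2 ^ c) ^ Fintype.card V := by
  rw [Nat.card_eq_fintype_card, Fintype.card_subtype]
  set k := Fintype.card V - Fintype.card V / c with hk
  have hsub : (univ.filter fun G : SimpleGraph V =>
        ∀ v, ∃ X : Finset V, v ∈ X ∧ X.card ≤ c ∧ IsAdjClosed G X) ⊆
      (univ.filter fun r : V → V => (univ.filter fun v => r v ≠ v).card ≤ k ∧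
        ∀ v, (univ.filter fun u => r u = r v).card ≤ c).biUnion fun r =>
      univ.filter fun G : SimpleGraph V => ∀ u v, G.Adj u v → r u = r v := by
    intro G hG
    have hG := (mem_filter.mp hG).2
    let r : V → V := fun v => (G.connectedComponentMk v).out
    have hmk : ∀ v, G.connectedComponentMk (r v) = G.connectedComponentMk v :=
      fun v => Quot.out_eq _
    have hfib : ∀ v, (univ.filter fun u => r u = r v).card ≤ c := by
      intro v
      obtain ⟨X, hvX, hXc, hX⟩ := hG v
      refine (card_le_card fun u hu => ?_).trans hXc
      have hru := (mem_filter.mp hu).2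
      have hreach : G.Reachable v u := by
        rw [← SimpleGraph.ConnectedComponent.eq, ← hmk u, ← hmk v, hru]
      obtain ⟨p⟩ := hreach
      clear hu hru
      induction p with
      | nil => exact hvX
      | cons h p ih => exact ih (hX _ hvX _ h)
    refine mem_biUnion.mpr ⟨r, mem_filter.mpr ⟨mem_univ _, ?_, hfib⟩, mem_filter.mpr
      ⟨mem_univ _, fun u v huv => ?_⟩⟩
    · have h1 : (univ : Finset V).card ≤ c * (univ.image r).card :=
        card_le_mul_card_image _ c fun a ha => by
          obtain ⟨v, -, rfl⟩ := mem_image.mp ha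
          exact hfib v
      have h2 : univ.image r ⊆ univ.filter fun v => r v = v := by
        intro a ha
        obtain ⟨v, -, rfl⟩ := mem_image.mp ha
        refine mem_filter.mpr ⟨mem_univ _, ?_⟩
        change (G.connectedComponentMk (r v)).out = _
        rw [hmk]
      have h3 := card_le_card h2
      have h4 : _ + (univ.filter fun v => r v ≠ v).card = _ :=
        card_filter_add_card_filter_not (s := univ) (fun v => r v = v)
      rw [card_univ] at h1 h4
      have h5 : Fintype.card V / c ≤ (univ.image r).card := Nat.div_le_of_le_mul h1
      omega
    · change Quot.out _ = Quot.out _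
      rw [SimpleGraph.ConnectedComponent.sound huv.reachable]
  refine (card_le_card hsub).trans ((card_biUnion_le_card_mul _ _ _ fun r hr =>
    card_within_fibers_le r (mem_filter.mp hr).2.2).trans (Nat.mul_le_mul_right _ ?_))
  refine (card_le_card fun r hr => ?_).trans (card_moving_le_pow k hV)
  exact mem_filter.mpr ⟨mem_univ _, (mem_filter.mp hr).2.1⟩

theorem exists_card_regular_tww_eq_zero_le_exp :
    ∃ C : ℝ, ∀ n : ℕ, 0 < n →
      (Nat.card {G : SimpleGraph (Fin n) // IsReg G 2 ∧ tww G = 0} : ℝ) ≤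
        Real.exp ((3 / 4 : ℝ) * (n * Real.log n) + C * n) := by
  refine ⟨Real.log 2 + 1 + Real.log 16, fun n hn => ?_⟩
  have hn0 : (0 : ℝ) < n := by exact_mod_cast hn
  have hcount : Nat.card {G : SimpleGraph (Fin n) // IsReg G 2 ∧ tww G = 0} ≤
      2 ^ n * n ^ (n - n / 4) * 16 ^ n := by
    have := card_small_components_le (V := Fin n) 4 (by simpa using hn)
    rw [Fintype.card_fin] at this
    refine le_trans (Nat.card_le_card_of_injective (fun G => ⟨G.1, fun v =>
      exists_isAdjClosed_of_tww_eq_zero two_pos G.2.1 (seqOK_of_tww_le G.2.2.le) v⟩)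
      fun G G' hGG => ?_) this
    exact Subtype.ext (congrArg (fun G => G.1) hGG)
  have hpow : ∀ {a : ℝ} (k : ℕ), 0 < a → a ^ k = Real.exp (k * Real.log a) := fun k ha => by
    rw [Real.exp_nat_mul, Real.exp_log ha]
  refine (Nat.cast_le.mpr hcount).trans ?_
  push_cast
  rw [hpow _ two_pos, hpow _ hn0, hpow _ (by norm_num : (0 : ℝ) < 16), ← Real.exp_add,
    ← Real.exp_add]
  refine Real.exp_le_exp.mpr ?_
  have hk : ((n - n / 4 : ℕ) : ℝ) ≤ 3 / 4 * n + 1 := by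
    have : 4 * (n - n / 4) ≤ 3 * n + 4 := by omega
    have : 4 * ((n - n / 4 : ℕ) : ℝ) ≤ 3 * n + 4 := by exact_mod_cast this
    linarith
  have h1 := mul_le_mul_of_nonneg_right hk (Real.log_natCast_nonneg n)
  have h2 : Real.log n ≤ n := (Real.log_le_sub_one_of_pos hn0).trans (by linarith)
  linarith

end SmallComponents

section Assembly

lemma exists_exp_le_mul_exp (c C₁ C₂ : ℝ) {gap δ : ℝ} (hgap : 0 < gap) (hδ : 0 < δ) :
    ∃ N : ℕ, ∀ n : ℕ, N ≤ n → Real.exp ((c - gap) * (n * Real.log n) + C₁ * n) ≤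
      δ * Real.exp (c * (n * Real.log n) - C₂ * n) := by
  have htend : Filter.Tendsto (fun n : ℕ => Real.log n) Filter.atTop Filter.atTop :=
    Real.tendsto_log_atTop.comp tendsto_natCast_atTop_atTop
  obtain ⟨N, hN⟩ := Filter.eventually_atTop.mp
    (htend.eventually_ge_atTop ((C₁ + C₂ + |Real.log δ|) / gap))
  refine ⟨max N 1, fun n hn => ?_⟩
  have hn1 : (1 : ℝ) ≤ n := by exact_mod_cast (le_max_right _ _).trans hn
  have h := hN n ((le_max_left _ _).trans hn)
  rw [div_le_iff₀ hgap] at h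
  have h1 := mul_le_mul_of_nonneg_right h (by linarith : (0 : ℝ) ≤ n)
  have h2 : |Real.log δ| ≤ |Real.log δ| * n := le_mul_of_one_le_right (abs_nonneg _) hn1
  have h3 := neg_abs_le (Real.log δ)
  calc _ ≤ Real.exp (Real.log δ + (c * (n * Real.log n) - C₂ * n)) :=
        Real.exp_le_exp.mpr (by linarith)
    _ = _ := by rw [Real.exp_add, Real.exp_log hδ]

/-- Regular graphs whose twin-width is below the threshold are a negligible fraction, on the
logarithmic scale. -/
theorem exists_card_regular_tww_lt_le_exp {d : ℕ} (hd : 2 ≤ d) {ε : ℝ} (hε : 0 < ε) :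
    ∃ gap : ℝ, 0 < gap ∧ ∃ C : ℝ, ∀ n : ℕ, 0 < n → Even (n * d) →
      (Nat.card {G : SimpleGraph (Fin n) // IsReg G d ∧
        (tww G : ℝ) < (n : ℝ) ^ (((d : ℝ) - 2) / (2 * (d : ℝ) - 2) - ε)} : ℝ) ≤
        Real.exp (((d : ℝ) / 2 - gap) * (n * Real.log n) + C * n) := by
  rcases hd.eq_or_lt with rfl | hd3
  · obtain ⟨C, hC⟩ := exists_card_regular_tww_eq_zero_le_exp
    refine ⟨1 / 4, by norm_num, C, fun n hn _ => ?_⟩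
    have hn1 : (1 : ℝ) ≤ n := by exact_mod_cast hn
    have hzero : ∀ G : SimpleGraph (Fin n),
        (tww G : ℝ) < (n : ℝ) ^ ((((2 : ℕ) : ℝ) - 2) / (2 * ((2 : ℕ) : ℝ) - 2) - ε) →
          tww G = 0 := fun G hG => by
      have h1 : (n : ℝ) ^ ((((2 : ℕ) : ℝ) - 2) / (2 * ((2 : ℕ) : ℝ) - 2) - ε) ≤ 1 :=
        Real.rpow_le_one_of_one_le_of_nonpos hn1 (by norm_num [hε.le])
      have h2 : (tww G : ℝ) < (1 : ℕ) := by simpa using hG.trans_le h1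
      exact Nat.lt_one_iff.mp (Nat.cast_lt.mp h2)
    refine (Nat.cast_le.mpr (Nat.card_le_card_of_injective
      (fun G => ⟨G.1, G.2.1, hzero G.1 G.2.2⟩) fun G G' hGG =>
        Subtype.ext (congrArg (fun G => G.1) hGG))).trans ((hC n hn).trans (le_of_eq ?_))
    norm_num
  · have hdR : (3 : ℝ) ≤ d := by exact_mod_cast hd3
    set α : ℝ := ((d : ℝ) - 2) / (2 * (d : ℝ) - 2) with hα
    have hα0 : 0 < α := div_pos (by linarith) (by linarith)
    have hα1 : α ≤ 1 := (div_le_one (by linarith)).mpr (by linarith)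
    have hαd : ((d : ℝ) - 1) * α = (d - 2) / 2 := by
      rw [hα]
      have : (d : ℝ) - 1 ≠ 0 := by linarith
      have : 2 * (d : ℝ) - 2 ≠ 0 := by linarith
      field_simp
    set η := min ε α with hη
    have hη0 : 0 < η := lt_min hε hα0
    obtain ⟨C, hC⟩ := exists_card_regular_tww_le_exp hd (τ := α - η / 2) (δ := α - η)
      (sub_nonneg.mpr (min_le_right _ _)) (by linarith) (by linarith)
    refine ⟨η * (3 * d / 4 - 1 / 2), mul_pos hη0 (by linarith), C, fun n hn heven => ?_⟩
    have hn1 : (1 : ℝ) ≤ n := by exact_mod_cast hn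
    have hle : (n : ℝ) ^ (α - ε) ≤ (n : ℝ) ^ (α - η) :=
      Real.rpow_le_rpow_of_exponent_le hn1 (sub_le_sub_left (min_le_left _ _) _)
    refine (Nat.cast_le.mpr (Nat.card_le_card_of_injective
      (fun G => ⟨G.1, G.2.1, G.2.2.le.trans hle⟩) fun G G' hGG =>
        Subtype.ext (congrArg (fun G => G.1) hGG))).trans ((hC n hn heven).trans (le_of_eq ?_))
    congr 3
    linear_combination hαd

end Assembly

theorem statement_19 (d : ℕ) (hd : 2 ≤ d) :
    (∀ ε : ℝ, 0 < ε → ∃ N : ℕ, ∀ n : ℕ, N ≤ n →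
      ∀ G : SimpleGraph (Fin n), IsReg G d →
        (tww G : ℝ) ≤ (n : ℝ) ^ (((d : ℝ) - 2) / (2 * (d : ℝ) - 2) + ε)) ∧
    (∀ ε δ : ℝ, 0 < ε → 0 < δ → ∃ N : ℕ, ∀ n : ℕ, N ≤ n →
      (Nat.card {G : SimpleGraph (Fin n) // IsReg G d ∧
          ¬ ((n : ℝ) ^ (((d : ℝ) - 2) / (2 * (d : ℝ) - 2) - ε) ≤ (tww G : ℝ) ∧
             (tww G : ℝ) ≤ (n : ℝ) ^ (((d : ℝ) - 2) / (2 * (d : ℝ) - 2) + ε))} : ℝ)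
        ≤ δ * Nat.card {G : SimpleGraph (Fin n) // IsReg G d}) := by
  refine ⟨fun ε hε => tww_le_rpow d hd ε hε, fun ε δ hε hδ => ?_⟩
  obtain ⟨N₁, hN₁⟩ := tww_le_rpow d hd ε hε
  obtain ⟨gap, hgap, C₁, hfew⟩ := exists_card_regular_tww_lt_le_exp hd hε
  obtain ⟨C₂, N₂, hmany⟩ := exists_exp_le_card_regular (two_pos.trans_le hd)
  obtain ⟨N₃, hratio⟩ := exists_exp_le_mul_exp ((d : ℝ) / 2) C₁ C₂ hgap hδ
  refine ⟨max (max N₁ N₂) (max N₃ 1), fun n hn => ?_⟩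
  simp only [max_le_iff] at hn
  obtain ⟨⟨h1, h2⟩, h3, hn0⟩ := hn
  by_cases heven : Even (n * d)
  · refine (Nat.cast_le.mpr (Nat.card_le_card_of_injective
      (fun G => ⟨G.1, G.2.1, lt_of_not_ge fun hge => G.2.2 ⟨hge, hN₁ n h1 G.1 G.2.1⟩⟩)
      fun G G' hGG => Subtype.ext (congrArg (fun G => G.1) hGG))).trans
      ((hfew n hn0 heven).trans ((hratio n h3).trans ?_))
    exact mul_le_mul_of_nonneg_left (hmany n h2 heven) hδ.le
  · have : IsEmpty {G : SimpleGraph (Fin n) // IsReg G d ∧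
        ¬ ((n : ℝ) ^ (((d : ℝ) - 2) / (2 * (d : ℝ) - 2) - ε) ≤ (tww G : ℝ) ∧
          (tww G : ℝ) ≤ (n : ℝ) ^ (((d : ℝ) - 2) / (2 * (d : ℝ) - 2) + ε))} :=
      ⟨fun G => heven G.2.1.even⟩
    rw [Nat.card_of_isEmpty, Nat.cast_zero]
    positivity

end TwwPaper
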